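/- Let ℙ be a probability measure on Ω₊ under which (ω(x))_{x≥0} is stationary and ergodic, and suppose that ℙ-almost surely ω(0,i) = 1/2 for all i ≥ 3, and that ℙ[ω(0,1) < 1 and ω(1,1) < 1] > 0. Then the walk has zero speed: lim_{n→∞} X_n/n = 0, P_0-almost surely. -/

import Mathlib

open MeasureTheory Filter Set Topology ProbabilityTheory
open scoped ENNReal ENat

noncomputable section

/-- A cookie environment: `ω z i` is the strength of the `(i+1)`-st cookie at site `z`
(cookies at each site are indexed by `i = 0, 1, 2, …`). -/
abbrev CEnv : Type := ℤ → ℕ → ℝ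

/-- `ω` belongs to `Ω₊`, i.e. all cookie strengths lie in `[1/2, 1]`. -/
def IsCookieEnv (ω : CEnv) : Prop := ∀ z i, ω z i ∈ Set.Icc (1/2 : ℝ) 1

/-- The number of visits of the path `x` to the site `x n` at times `m < n`. -/
def prevVisits (x : ℕ → ℤ) (n : ℕ) : ℕ :=
  ((Finset.range n).filter fun m => x m = x n).card

/-- The probability of the step from `x n` to `x (n+1)` for the multi-excited random
walk: jump to the right with the strength of the bottom remaining cookie at the current
site, to the left with the complementary probability. -/
def stepProb (ω : CEnv) (x : ℕ → ℤ) (n : ℕ) : ℝ :=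
  if x (n+1) = x n + 1 then ω (x n) (prevVisits x n)
  else if x (n+1) = x n - 1 then 1 - ω (x n) (prevVisits x n)
  else 0

/-- The probability that the walk started at `x0` follows the path `x` up to time `n`. -/
def cylProb (ω : CEnv) (x0 : ℤ) (x : ℕ → ℤ) (n : ℕ) : ℝ :=
  (if x 0 = x0 then 1 else 0) * ∏ m ∈ Finset.range n, stepProb ω x m

/-- `P` is the law `P_{x0,ω}` of the multi-excited random walk in the cookie
environment `ω` started at `x0`, characterized by its cylinder probabilities. -/
def IsERWLaw (ω : CEnv) (x0 : ℤ) (P : Measure (ℕ → ℤ)) : Prop :=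
  IsProbabilityMeasure P ∧
    ∀ (x : ℕ → ℤ) (n : ℕ),
      P {Y | ∀ m ≤ n, Y m = x m} = ENNReal.ofReal (cylProb ω x0 x n)

/-- First passage time `T_k`, with value `∞` if `k` is never visited. -/
def T (k : ℤ) (Y : ℕ → ℤ) : ℕ∞ :=
  sInf {t : ℕ∞ | ∃ n : ℕ, (n : ℕ∞) = t ∧ Y n = k}

/-- First passage time of an extended-real level, with the convention
`T_{−∞} = T_{+∞} = ∞`. -/
def Te (k : EReal) (Y : ℕ → ℤ) : ℕ∞ :=
  sInf {t : ℕ∞ | ∃ n : ℕ, (n : ℕ∞) = t ∧ ((Y n : ℝ) : EReal) = k}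

/-- `R_k`, the event that the site `k` is visited infinitely often. -/
def Rset (k : ℤ) : Set (ℕ → ℤ) := {Y | ∀ N : ℕ, ∃ n ≥ N, Y n = k}

/-- The number of visits of `Y` to the site `s` at times `< t`. -/
def visitsBefore (Y : ℕ → ℤ) (s : ℤ) (t : ℕ∞) : ℕ∞ :=
  {m : ℕ | (m : ℕ∞) < t ∧ Y m = s}.encard

/-- `D_t^s`: the total drift stored in the cookies consumed at the site `s`
before time `t` (a time in `ℕ∞`; `t = ∞` gives `D_∞^s`). -/
def driftAt (ω : CEnv) (Y : ℕ → ℤ) (s : ℤ) (t : ℕ∞) : ℝ≥0∞ :=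
  ∑' i : ℕ, Set.indicator {i : ℕ | (i : ℕ∞) < visitsBefore Y s t}
    (fun i => ENNReal.ofReal (2 * ω s i - 1)) i

/-- `D_t`: the total drift consumed before time `t` (at all sites). -/
def Dtot (ω : CEnv) (Y : ℕ → ℤ) (t : ℕ∞) : ℝ≥0∞ := ∑' s : ℤ, driftAt ω Y s t

/-- `D_t^+`: the total drift consumed at nonnegative sites before time `t`. -/
def DtotPos (ω : CEnv) (Y : ℕ → ℤ) (t : ℕ∞) : ℝ≥0∞ := ∑' s : ℕ, driftAt ω Y (s : ℤ) t

/-- `δ^s`: the total drift stored in the cookies at the site `s`. -/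
def cookieDrift (ω : CEnv) (s : ℤ) : ℝ≥0∞ := ∑' i : ℕ, ENNReal.ofReal (2 * ω s i - 1)

/-- The successive times `τ_{k,1}, τ_{k,2}, …` (indexed here from `0`) at which the
walk is at a site `≥ k`. -/
def tauT (k : ℤ) (Y : ℕ → ℤ) : ℕ → ℕ∞
  | 0 => sInf {t : ℕ∞ | ∃ n : ℕ, (n : ℕ∞) = t ∧ k ≤ Y n}
  | m + 1 => sInf {t : ℕ∞ | ∃ n : ℕ, (n : ℕ∞) = t ∧ tauT k Y m < (n : ℕ∞) ∧ k ≤ Y n}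

/-- The observed sequence `(X_{τ_{k,m}})_{m ≥ 1}` (indexed here from `0`). -/
def obsSeq (k : ℤ) (Y : ℕ → ℤ) (m : ℕ) : ℤ := Y (tauT k Y m).toNat

/-- The one-sided shift on sequences. -/
def shiftSeq {α : Type*} (u : ℕ → α) : ℕ → α := fun n => u (n + 1)

/-- The restriction `(ω(x))_{x ≥ 0}` of an environment to the nonnegative sites. -/
def restrictNN (ω : CEnv) : ℕ → ℕ → ℝ := fun x => ω (x : ℤ)

/-- `(ω(x))_{x ≥ 0}` is stationary under `Pr`: its law is invariant under the shift. -/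
def IsStationaryEnv (Pr : Measure CEnv) : Prop :=
  MeasurePreserving shiftSeq (Pr.map restrictNN) (Pr.map restrictNN)

/-- `(ω(x))_{x ≥ 0}` is stationary and ergodic under `Pr`. -/
def IsStatErgEnv (Pr : Measure CEnv) : Prop :=
  Ergodic shiftSeq (Pr.map restrictNN)

/-- The process `ξ_k = ((ω(x+k))_{x≥0}, (X_{τ_{k,m}} − k)_{m≥0})` consisting of the
environment to the right of `k` and the trajectory at sites `≥ k`, recentered at `k`. -/
def xiProc (p : CEnv × (ℕ → ℤ)) (k : ℕ) : (ℕ → ℕ → ℝ) × (ℕ → ℤ) :=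
  (fun x : ℕ => p.1 ((x : ℤ) + (k : ℤ)), fun m => obsSeq (k : ℤ) p.2 m - (k : ℤ))

/-- A covering argument: if from `x` one finds within `N` steps a block on which the Birkhoff
sum of `g` is at most `ε` times its length, except at points of `F`, then Birkhoff sums of `g`
are at most `ε M + N` up to the number of visits to `F`. -/
lemma birkhoffSum_le_of_short_blocks {α : Type*} {f : α → α} {g h : α → ℝ} {ε : ℝ} {N : ℕ}
    (hε : 0 ≤ ε) (hg1 : ∀ x, g x ≤ 1) (hh0 : ∀ x, 0 ≤ h x)
    (H : ∀ x, 1 ≤ h x ∨ ∃ n, 1 ≤ n ∧ n ≤ N ∧ birkhoffSum f g n x ≤ ε * n) (M : ℕ) (x : α) :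
    birkhoffSum f g M x ≤ ε * M + N + birkhoffSum f h M x := by
  induction M using Nat.strong_induction_on generalizing x with
  | _ M ih =>
    have hS : 0 ≤ birkhoffSum f h M x := Finset.sum_nonneg fun i _ => hh0 _
    rcases le_or_gt M N with hMN | hMN
    · have h1 : birkhoffSum f g M x ≤ M := by
        have := Finset.sum_le_card_nsmul (Finset.range M) (fun k => g (f^[k] x)) 1
          (fun i _ => hg1 _)
        simpa [birkhoffSum] using this
      have h2 : (M : ℝ) ≤ N := by exact_mod_cast hMN
      have h3 : 0 ≤ ε * M := by positivity
      linarith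
    · rcases H x with h1 | ⟨n, hn1, hnN, hn⟩
      · obtain ⟨m, rfl⟩ : ∃ m, M = m + 1 := ⟨M - 1, by omega⟩
        have := ih m (by omega) (f x)
        rw [birkhoffSum_succ', birkhoffSum_succ']
        push_cast
        linarith [hg1 x]
      · obtain ⟨m, rfl⟩ : ∃ m, M = n + m := ⟨M - n, by omega⟩
        have := ih m (by omega) (f^[n] x)
        rw [birkhoffSum_add, birkhoffSum_add]
        have h0 : 0 ≤ birkhoffSum f h n x := Finset.sum_nonneg fun i _ => hh0 _
        push_cast
        linarith

lemma measurable_birkhoffSum {α : Type*} [MeasurableSpace α] {f : α → α} {g : α → ℝ}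
    (hf : Measurable f) (hg : Measurable g) (n : ℕ) : Measurable (birkhoffSum f g n) :=
  Finset.measurable_sum _ fun i _ => hg.comp (hf.iterate i)

lemma integral_birkhoffSum {α : Type*} [MeasurableSpace α] {μ : Measure α} {f : α → α}
    {g : α → ℝ} (hf : MeasurePreserving f μ μ) (hg : Integrable g μ) (n : ℕ) :
    Integrable (birkhoffSum f g n) μ ∧ ∫ x, birkhoffSum f g n x ∂μ = n * ∫ x, g x ∂μ := by
  have hi : ∀ k, Integrable (fun x => g (f^[k] x)) μ := fun k =>
    (hf.iterate k).integrable_comp_of_integrable hg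
  refine ⟨integrable_finsetSum _ fun i _ => hi i, ?_⟩
  simp only [birkhoffSum]
  rw [integral_finsetSum _ fun i _ => hi i]
  have : ∀ k, ∫ x, g (f^[k] x) ∂μ = ∫ x, g x ∂μ := fun k => by
    have hm := hf.iterate k
    have h2 := integral_map (μ := μ) hm.measurable.aemeasurable (f := g)
      (by rw [hm.map_eq]; exact hg.aestronglyMeasurable)
    rw [hm.map_eq] at h2
    exact h2.symm
  simp [this]

/-- Weak form of the pointwise ergodic theorem: the Birkhoff averages of a function with values
in `[0, 1]` and positive mean are eventually bounded away from zero. -/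
lemma Ergodic.ae_eventually_le_birkhoffSum {α : Type*} [MeasurableSpace α] {μ : Measure α}
    [IsProbabilityMeasure μ] {f : α → α} {g : α → ℝ} (hf : Ergodic f μ) (hg : Measurable g)
    (hg0 : ∀ x, 0 ≤ g x) (hg1 : ∀ x, g x ≤ 1) (hpos : 0 < ∫ x, g x ∂μ) :
    ∀ᵐ x ∂μ, ∃ γ : ℝ, 0 < γ ∧ ∀ᶠ n : ℕ in atTop, γ * n ≤ birkhoffSum f g n x := by
  have hfm := hf.toMeasurePreserving.measurable
  have hSm := fun n => measurable_birkhoffSum hfm hg n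
  have hgi : Integrable g μ := Integrable.of_bound hg.aestronglyMeasurable 1
    (ae_of_all _ fun x => by rw [Real.norm_of_nonneg (hg0 x)]; exact hg1 x)
  set B : Set α := {x | ∀ j : ℕ, ∀ m : ℕ, ∃ n, m ≤ n ∧ (j + 1) * birkhoffSum f g n x < n} with hB
  have hBm : MeasurableSet B := by
    have : B = ⋂ j : ℕ, ⋂ m : ℕ, ⋃ n : ℕ, ⋃ _ : m ≤ n,
        {x | (j + 1 : ℝ) * birkhoffSum f g n x < n} := by
      ext x; simp [hB]
    rw [this]
    exact MeasurableSet.iInter fun j => MeasurableSet.iInter fun m => MeasurableSet.iUnion fun n =>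
      MeasurableSet.iUnion fun _ => measurableSet_lt ((hSm n).const_mul _) measurable_const
  have hBinv : f ⁻¹' B = B := by
    ext x
    constructor
    · intro hx j m
      obtain ⟨n, hn, h⟩ := hx (2 * j + 1) (m + 2 * j + 2)
      refine ⟨n + 1, by omega, ?_⟩
      rw [birkhoffSum_succ']
      have h2 : ((m + 2 * j + 2 : ℕ) : ℝ) ≤ n := by exact_mod_cast hn
      push_cast at h h2 ⊢
      have h3 : (j + 1 : ℝ) * g x ≤ (j + 1) * 1 :=
        mul_le_mul_of_nonneg_left (hg1 x) (by positivity)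
      have h4 : (0 : ℝ) ≤ m := by positivity
      linarith
    · intro hx j m
      obtain ⟨n, hn, h⟩ := hx (2 * j + 1) (m + 2)
      obtain ⟨n, rfl⟩ : ∃ k, n = k + 1 := ⟨n - 1, by omega⟩
      refine ⟨n, by omega, ?_⟩
      rw [birkhoffSum_succ'] at h
      have h2 : ((m + 2 : ℕ) : ℝ) ≤ (n + 1 : ℕ) := by exact_mod_cast hn
      push_cast at h h2 ⊢
      have h3 : 0 ≤ (2 * j + 1 + 1 : ℝ) * g x := mul_nonneg (by positivity) (hg0 x)
      have h4 : (0 : ℝ) ≤ m := by positivity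
      linarith
  rcases hf.toPreErgodic.ae_mem_or_ae_notMem hBm hBinv with hae | hae
  · exfalso
    obtain ⟨j, hj⟩ := exists_nat_one_div_lt hpos
    set ε : ℝ := 1 / ((j : ℝ) + 1) with hεd
    have hε0 : 0 < ε := by positivity
    let E : ℕ → Set α := fun N => {x | ∀ n, 1 ≤ n → n ≤ N → ε * n < birkhoffSum f g n x}
    have hEm : ∀ N, MeasurableSet (E N) := fun N => by
      have : E N = ⋂ n : ℕ, ⋂ _ : 1 ≤ n, ⋂ _ : n ≤ N, {x | ε * n < birkhoffSum f g n x} := by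
        ext x; simp [E]
      rw [this]
      exact MeasurableSet.iInter fun n => MeasurableSet.iInter fun _ => MeasurableSet.iInter
        fun _ => measurableSet_lt measurable_const (hSm n)
    have hEanti : Antitone E := fun a b hab x hx n h1 h2 => hx n h1 (h2.trans hab)
    have hEinter : μ (⋂ N, E N) = 0 := by
      refine measure_mono_null (fun x hx => ?_) hae
      simp only [mem_iInter] at hx
      intro hxB
      obtain ⟨n, hn, h⟩ := hxB j 1
      have h2 := hx n n hn le_rfl
      have h3 : ε * n < ε * n := h2.trans (by
        rw [hεd, div_mul_eq_mul_div, one_mul, lt_div_iff₀ (by positivity)]; linarith)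
      exact lt_irrefl _ h3
    have hlim : Tendsto (fun N => μ.real (E N)) atTop (𝓝 0) := by
      have := tendsto_measure_iInter_atTop (μ := μ) (s := E)
        (fun N => (hEm N).nullMeasurableSet) hEanti ⟨0, measure_ne_top _ _⟩
      rw [hEinter] at this
      simpa [Measure.real, Function.comp_def] using (ENNReal.tendsto_toReal ENNReal.zero_ne_top).comp this
    have key : ∀ N, ∫ x, g x ∂μ ≤ ε + μ.real (E N) := by
      intro N
      have hi : Integrable ((E N).indicator fun _ => (1 : ℝ)) μ :=
        (integrable_const _).indicator (hEm N)
      have hM : ∀ M : ℕ, M * ∫ x, g x ∂μ ≤ ε * M + N + M * μ.real (E N) := by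
        intro M
        obtain ⟨i1, e1⟩ := integral_birkhoffSum hf.toMeasurePreserving hgi M
        obtain ⟨i2, e2⟩ := integral_birkhoffSum hf.toMeasurePreserving hi M
        have hle : ∀ x, birkhoffSum f g M x ≤ (ε * M + N) +
            birkhoffSum f ((E N).indicator fun _ => (1 : ℝ)) M x := by
          refine birkhoffSum_le_of_short_blocks hε0.le hg1
            (fun x => Set.indicator_nonneg (fun _ _ => zero_le_one) x) (fun x => ?_) M
          by_cases hx : x ∈ E N
          · left; simp [hx]
          · right
            simp only [E, mem_ofPred_eq] at hx
            push Not at hx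
            exact hx
        have := integral_mono i1 ((integrable_const _).add i2) hle
        rw [e1] at this
        simp only [Pi.add_apply] at this
        rw [integral_add (integrable_const _) i2, e2] at this
        simpa [integral_indicator (hEm N)] using this
      by_contra hcon
      push Not at hcon
      obtain ⟨M, hM'⟩ := exists_nat_gt ((N : ℝ) / (∫ x, g x ∂μ - (ε + μ.real (E N))))
      rw [div_lt_iff₀ (by linarith)] at hM'
      have := hM M
      nlinarith
    have := ge_of_tendsto' (hlim.const_add ε) key
    linarith
  · filter_upwards [hae] with x hx
    simp only [hB, mem_ofPred_eq] at hx
    push Not at hx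
    obtain ⟨j, m, h⟩ := hx
    refine ⟨1 / (j + 1), by positivity, ?_⟩
    filter_upwards [eventually_ge_atTop m] with n hn
    rw [div_mul_eq_mul_div, one_mul, div_le_iff₀ (by positivity)]
    linarith [h n hn]

/-- For independent coins with success probabilities `p 0, p 1, …`, the probability that exactly
`l` failures precede the `r`-th success. -/
def failProb (p : ℕ → ℝ) (r l : ℕ) : ℝ :=
  match r, l with
  | 0, 0 => 1
  | 0, _ + 1 => 0
  | r + 1, 0 => p 0 * failProb (fun i => p (i + 1)) r 0
  | r + 1, l + 1 => p 0 * failProb (fun i => p (i + 1)) r (l + 1) +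
      (1 - p 0) * failProb (fun i => p (i + 1)) (r + 1) l
termination_by r + l

lemma failProb_nonneg {p : ℕ → ℝ} (hp : ∀ i, p i ∈ Icc (0 : ℝ) 1) (r l : ℕ) :
    0 ≤ failProb p r l := by
  induction hn : r + l using Nat.strong_induction_on generalizing p r l with
  | _ n ih =>
    have hp' : ∀ i, (fun i => p (i + 1)) i ∈ Icc (0 : ℝ) 1 := fun i => hp _
    match r, l with
    | 0, 0 => simp [failProb]
    | 0, l + 1 => simp [failProb]
    | r + 1, 0 =>
      rw [failProb]
      exact mul_nonneg (hp 0).1 (ih _ (by omega) hp' r 0 rfl)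
    | r + 1, l + 1 =>
      rw [failProb]
      exact add_nonneg (mul_nonneg (hp 0).1 (ih _ (by omega) hp' r (l + 1) rfl))
        (mul_nonneg (sub_nonneg.2 (hp 0).2) (ih _ (by omega) hp' (r + 1) l rfl))

lemma failProb_zero_le {p : ℕ → ℝ} (hp : ∀ i, p i ∈ Icc (0 : ℝ) 1) (r : ℕ) :
    failProb p r 0 ≤ 1 := by
  induction r generalizing p with
  | zero => simp [failProb]
  | succ r ih =>
    rw [failProb]
    exact mul_le_one₀ (hp 0).2 (failProb_nonneg (fun i => hp _) _ _) (ih fun i => hp _)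

lemma failProb_succ_zero_le {p : ℕ → ℝ} (hp : ∀ i, p i ∈ Icc (0 : ℝ) 1) (r : ℕ) :
    failProb p (r + 1) 0 ≤ p 0 := by
  rw [failProb]
  exact mul_le_of_le_one_right (hp 0).1 (failProb_zero_le (fun i => hp _) r)

/-- Conditioning the generating function of the number of failures on the first coin. -/
lemma hasSum_failProb_succ {p : ℕ → ℝ} {s a b : ℝ} {r : ℕ}
    (ha : HasSum (fun l => failProb (fun i => p (i + 1)) r l * s ^ l) a)
    (hb : HasSum (fun l => failProb (fun i => p (i + 1)) (r + 1) l * s ^ l) b) :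
    HasSum (fun l => failProb p (r + 1) l * s ^ l) (p 0 * a + (1 - p 0) * s * b) := by
  have h1 := ha.mul_left (p 0)
  have h2 : HasSum (fun l => Nat.rec (motive := fun _ => ℝ) 0 (fun l _ => (1 - p 0) * s *
      (failProb (fun i => p (i + 1)) (r + 1) l * s ^ l)) l) ((1 - p 0) * s * b) := by
    rw [← hasSum_nat_add_iff' 1]
    simpa using hb.mul_left ((1 - p 0) * s)
  have e : (fun l => failProb p (r + 1) l * s ^ l) = fun l =>
      p 0 * (failProb (fun i => p (i + 1)) r l * s ^ l) + Nat.rec (motive := fun _ => ℝ) 0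
        (fun l _ => (1 - p 0) * s * (failProb (fun i => p (i + 1)) (r + 1) l * s ^ l)) l := by
    funext l
    cases l with
    | zero => simp [failProb]
    | succ l => simp only [failProb]; ring
  rw [e]
  exact h1.add h2

lemma hasSum_failProb_zero (p : ℕ → ℝ) (s : ℝ) :
    HasSum (fun l => failProb p 0 l * s ^ l) 1 := by
  convert hasSum_single 0 ?_ using 1
  · simp [failProb]
  · intro l hl
    obtain ⟨l, rfl⟩ := Nat.exists_eq_succ_of_ne_zero hl
    simp [failProb]

lemma failProb_half (r l : ℕ) :
    failProb (fun _ => 1 / 2) (r + 1) l = (l + r).choose r * (1 / 2 : ℝ) ^ (r + 1 + l) := by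
  induction hn : r + l using Nat.strong_induction_on generalizing r l with
  | _ n ih =>
    match r, l with
    | 0, 0 => simp [failProb]
    | 0, l + 1 =>
      rw [failProb, failProb, ih (0 + l) (by omega) 0 l rfl]
      simp
      ring
    | r + 1, 0 =>
      rw [failProb, ih (r + 0) (by omega) r 0 rfl]
      simp
      ring
    | r + 1, l + 1 =>
      rw [failProb, ih (r + (l + 1)) (by omega) r (l + 1) rfl,
        ih (r + 1 + l) (by omega) (r + 1) l rfl,
        show l + 1 + (r + 1) = (l + r + 1) + 1 by ring, Nat.choose_succ_succ,
        show l + 1 + r = l + r + 1 by ring, show l + (r + 1) = l + r + 1 by ring]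
      push_cast
      ring

lemma hasSum_failProb_half {s : ℝ} (hs0 : 0 ≤ s) (hs1 : s ≤ 1) (r : ℕ) :
    HasSum (fun l => failProb (fun _ => 1 / 2) r l * s ^ l) ((1 / (2 - s)) ^ r) := by
  cases r with
  | zero => simpa using hasSum_failProb_zero _ s
  | succ r =>
    have h := (hasSum_choose_mul_geometric_of_norm_lt_one r (r := s / 2) (by
      rw [Real.norm_of_nonneg (by positivity)]; linarith)).mul_left ((1 / 2 : ℝ) ^ (r + 1))
    have e : (fun l => failProb (fun _ => 1 / 2) (r + 1) l * s ^ l) =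
        fun l => (1 / 2 : ℝ) ^ (r + 1) * ((l + r).choose r * (s / 2) ^ l) := by
      funext l
      rw [failProb_half, div_pow s 2, pow_add (1 / 2 : ℝ) (r + 1) l, one_div_pow 2 l]
      ring
    have e2 : (1 / (2 - s)) ^ (r + 1) = (1 / 2 : ℝ) ^ (r + 1) * (1 / (1 - s / 2) ^ (r + 1)) := by
      rw [← one_div_pow (1 - s / 2), ← mul_pow]
      congr 1
      have : (2 - s) ≠ 0 := by linarith
      have : (1 - s / 2) ≠ 0 := by linarith
      field_simp
    rw [e, e2]
    exact h

/-- The generating function of the number of failures before the `(m+1)`-st success when only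
the first two coins may be biased. -/
def failGen (p₀ p₁ s : ℝ) (m : ℕ) : ℝ :=
  p₀ * (if m = 0 then 1 else p₁ * (1 / (2 - s)) ^ (m - 1) + (1 - p₁) * s * (1 / (2 - s)) ^ m) +
    (1 - p₀) * s * (p₁ * (1 / (2 - s)) ^ m + (1 - p₁) * s * (1 / (2 - s)) ^ (m + 1))

lemma hasSum_failProb_two {p : ℕ → ℝ} (hp : ∀ i, 2 ≤ i → p i = 1 / 2) {s : ℝ} (hs0 : 0 ≤ s)
    (hs1 : s ≤ 1) (m : ℕ) :
    HasSum (fun l => failProb p (m + 1) l * s ^ l) (failGen (p 0) (p 1) s m) := by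
  have hhalf : (fun i => p (i + 1 + 1)) = fun _ => 1 / 2 := by
    ext i; exact hp _ (by omega)
  have h2 := hasSum_failProb_half hs0 hs1
  have h1 : ∀ r, HasSum (fun l => failProb (fun i => p (i + 1)) (r + 1) l * s ^ l)
      (p 1 * (1 / (2 - s)) ^ r + (1 - p 1) * s * (1 / (2 - s)) ^ (r + 1)) := fun r =>
    hasSum_failProb_succ (p := fun i => p (i + 1)) (by rw [hhalf]; exact h2 r)
      (by rw [hhalf]; exact h2 (r + 1))
  refine hasSum_failProb_succ ?_ (h1 m)
  cases m with
  | zero => simpa using hasSum_failProb_zero _ s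
  | succ m => simpa using h1 m

/-- The functions `m ↦ ∑_{i<m} (t/(t+1))^i`, which are truncations at height `t + 1` of the
identity adapted to negative binomial transitions. -/
def truncId (t m : ℕ) : ℝ := ∑ i ∈ Finset.range m, ((t : ℝ) / (t + 1)) ^ i

lemma truncId_eq (t m : ℕ) : truncId t m = (t + 1) * (1 - ((t : ℝ) / (t + 1)) ^ m) := by
  have h : ((t : ℝ) / (t + 1)) ≠ 1 := by
    rw [Ne, div_eq_one_iff_eq (by positivity)]; linarith
  rw [truncId, geom_sum_eq h]
  have h1 : (t : ℝ) / (t + 1) - 1 = -(1 / (t + 1)) := by field_simp; ring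
  rw [h1]
  field_simp
  ring

lemma truncId_nonneg (t m : ℕ) : 0 ≤ truncId t m :=
  Finset.sum_nonneg fun i _ => by positivity

lemma truncId_le (t m : ℕ) : truncId t m ≤ m := by
  have : ∀ i ∈ Finset.range m, ((t : ℝ) / (t + 1)) ^ i ≤ 1 := fun i _ =>
    pow_le_one₀ (by positivity) ((div_le_one (by positivity)).2 (by linarith))
  simpa [truncId] using Finset.sum_le_card_nsmul _ _ _ this

lemma truncId_le_height (t m : ℕ) : truncId t m ≤ t + 1 := by
  rw [truncId_eq]
  have : 0 ≤ ((t : ℝ) / (t + 1)) ^ m := by positivity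
  nlinarith [(Nat.cast_nonneg t : (0 : ℝ) ≤ t)]

lemma truncId_le_succ (t m : ℕ) : truncId t m ≤ truncId (t + 1) m := by
  refine Finset.sum_le_sum fun i _ => pow_le_pow_left₀ (by positivity) ?_ i
  rw [div_le_div_iff₀ (by positivity) (by positivity)]
  push_cast
  nlinarith

/-- The part of the drift of `truncId t` that depends on the truncation level `t`. -/
def truncErr (p₀ p₁ : ℝ) (t m : ℕ) : ℝ :=
  2 * (p₀ * (1 - p₁) + (1 - p₀) * p₁) * (1 - (((t : ℝ) + 1) / (t + 2)) ^ m) +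
    4 * ((1 - p₀) * (1 - p₁)) * (1 - (((t : ℝ) + 1) / (t + 2)) ^ (m + 1))

/-- The part of the drift of `truncId t` that does not depend on the truncation level `t`. -/
def truncDrift (p₀ p₁ : ℝ) (m : ℕ) : ℝ :=
  if m = 0 then -((1 - p₀) * p₁ + 3 * ((1 - p₀) * (1 - p₁)))
  else 1 - 2 * (p₀ * (1 - p₁) + (1 - p₀) * p₁) - 4 * ((1 - p₀) * (1 - p₁))

lemma failGen_truncId (p₀ p₁ : ℝ) (t m : ℕ) :
    (t + 1) * (1 - failGen p₀ p₁ ((t : ℝ) / (t + 1)) m) =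
      truncId (t + 1) m - truncDrift p₀ p₁ m - truncErr p₀ p₁ t m := by
  have hq : 1 / (2 - (t : ℝ) / (t + 1)) = ((t : ℝ) + 1) / (t + 2) := by
    have : (2 - (t : ℝ) / (t + 1)) = (t + 2) / (t + 1) := by field_simp; ring
    rw [this, one_div_div]
  have hq' : (((t + 1 : ℕ) : ℝ) / ((t + 1 : ℕ) + 1)) = ((t : ℝ) + 1) / (t + 2) := by
    push_cast; congr 1; ring
  rw [truncId_eq, hq', failGen, hq, truncDrift, truncErr]
  have h1 : (t : ℝ) + 1 ≠ 0 := by positivity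
  have h2 : (t : ℝ) + 2 ≠ 0 := by positivity
  cases m with
  | zero =>
    simp
    field_simp
    ring
  | succ m =>
    simp only [Nat.succ_ne_zero, if_false, Nat.add_sub_cancel]
    generalize hx : (((t : ℝ) + 1) / (t + 2)) ^ m = x
    simp only [pow_succ, hx]
    push_cast
    field_simp
    ring

lemma hasSum_failProb_one {p : ℕ → ℝ} (hp2 : ∀ i, 2 ≤ i → p i = 1 / 2) (m : ℕ) :
    HasSum (fun l => failProb p (m + 1) l) 1 := by
  have h := hasSum_failProb_two hp2 zero_le_one le_rfl m
  have e : failGen (p 0) (p 1) 1 m = 1 := by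
    rw [failGen]
    norm_num
  rw [e] at h
  simpa using h

lemma hasSum_failProb_truncId {p : ℕ → ℝ} (hp2 : ∀ i, 2 ≤ i → p i = 1 / 2) (t m : ℕ) :
    HasSum (fun l => failProb p (m + 1) l * truncId t l)
      (truncId (t + 1) m - truncDrift (p 0) (p 1) m - truncErr (p 0) (p 1) t m) := by
  have h := hasSum_failProb_two hp2 (s := (t : ℝ) / (t + 1)) (by positivity)
    ((div_le_one (by positivity)).2 (by linarith)) m
  have h' := ((hasSum_failProb_one hp2 m).sub h).mul_left ((t : ℝ) + 1)
  rw [failGen_truncId] at h'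
  have e : (fun l => failProb p (m + 1) l * truncId t l) = fun l => ((t : ℝ) + 1) *
      (failProb p (m + 1) l - failProb p (m + 1) l * ((t : ℝ) / (t + 1)) ^ l) := by
    funext l
    rw [truncId_eq]
    ring
  rw [e]
  exact h'

lemma truncErr_le {p₀ p₁ : ℝ} (h₀ : p₀ ∈ Icc (0 : ℝ) 1) (h₁ : p₁ ∈ Icc (0 : ℝ) 1) (t m : ℕ) :
    truncErr p₀ p₁ t m ≤ 4 * (m + 1) / (t + 2) := by
  have hq0 : 0 ≤ ((t : ℝ) + 1) / (t + 2) := by positivity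
  have hq1 : ((t : ℝ) + 1) / (t + 2) ≤ 1 := (div_le_one (by positivity)).2 (by linarith)
  have hb : 1 - (((t : ℝ) + 1) / (t + 2)) ^ (m + 1) ≤ (m + 1) / (t + 2) := by
    have := one_add_mul_le_pow (a := -(1 / ((t : ℝ) + 2))) (by
      have : 1 / ((t : ℝ) + 2) ≤ 1 := (div_le_one (by positivity)).2 (by linarith)
      linarith) (m + 1)
    have e : 1 + -(1 / ((t : ℝ) + 2)) = ((t : ℝ) + 1) / (t + 2) := by field_simp; ring
    rw [e] at this
    push_cast at this
    have e2 : ((m : ℝ) + 1) * -(1 / (t + 2)) = -((m + 1) / (t + 2)) := by ring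
    linarith
  have hmono : (((t : ℝ) + 1) / (t + 2)) ^ (m + 1) ≤ (((t : ℝ) + 1) / (t + 2)) ^ m :=
    pow_le_pow_of_le_one hq0 hq1 (Nat.le_succ m)
  have h1 : (((t : ℝ) + 1) / (t + 2)) ^ m ≤ 1 := pow_le_one₀ hq0 hq1
  have e : 4 * ((m : ℝ) + 1) / (t + 2) = 4 * ((m + 1) / (t + 2)) := by ring
  rw [e, truncErr]
  generalize (((t : ℝ) + 1) / (t + 2)) ^ (m + 1) = y at *
  generalize (((t : ℝ) + 1) / (t + 2)) ^ m = x at *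
  have a1 : 0 ≤ p₀ * (1 - p₁) + (1 - p₀) * p₁ := add_nonneg
    (mul_nonneg h₀.1 (sub_nonneg.2 h₁.2)) (mul_nonneg (sub_nonneg.2 h₀.2) h₁.1)
  have a2 : 0 ≤ (1 - p₀) * (1 - p₁) := mul_nonneg (sub_nonneg.2 h₀.2) (sub_nonneg.2 h₁.2)
  have a3 : p₀ * (1 - p₁) + (1 - p₀) * p₁ + (1 - p₀) * (1 - p₁) ≤ 1 := by
    nlinarith [mul_nonneg h₀.1 h₁.1]
  nlinarith

lemma le_truncErr {p₀ p₁ : ℝ} (h₀ : p₀ ∈ Icc (0 : ℝ) 1) (h₁ : p₁ ∈ Icc (0 : ℝ) 1) (t m : ℕ) :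
    1 / ((t : ℝ) + 1) * ((1 - p₀) * if m = 0 then 0 else 1) ≤ truncErr p₀ p₁ t m := by
  have hq0 : 0 ≤ ((t : ℝ) + 1) / (t + 2) := by positivity
  have hq1 : ((t : ℝ) + 1) / (t + 2) ≤ 1 := (div_le_one (by positivity)).2 (by linarith)
  have hmono : (((t : ℝ) + 1) / (t + 2)) ^ (m + 1) ≤ (((t : ℝ) + 1) / (t + 2)) ^ m :=
    pow_le_pow_of_le_one hq0 hq1 (Nat.le_succ m)
  have h1 : (((t : ℝ) + 1) / (t + 2)) ^ m ≤ 1 := pow_le_one₀ hq0 hq1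
  have a1 : 0 ≤ p₀ * (1 - p₁) := mul_nonneg h₀.1 (sub_nonneg.2 h₁.2)
  have a1' : 0 ≤ (1 - p₀) * p₁ := mul_nonneg (sub_nonneg.2 h₀.2) h₁.1
  have a2 : 0 ≤ (1 - p₀) * (1 - p₁) := mul_nonneg (sub_nonneg.2 h₀.2) (sub_nonneg.2 h₁.2)
  have key : 2 * (1 - p₀) * (1 - (((t : ℝ) + 1) / (t + 2)) ^ m) ≤ truncErr p₀ p₁ t m := by
    rw [truncErr]
    generalize (((t : ℝ) + 1) / (t + 2)) ^ (m + 1) = y at *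
    generalize (((t : ℝ) + 1) / (t + 2)) ^ m = x at *
    nlinarith [mul_nonneg a1 (sub_nonneg.2 h1), mul_nonneg a2 (sub_nonneg.2 h1),
      mul_nonneg a2 (sub_nonneg.2 hmono)]
  refine le_trans ?_ key
  split_ifs with hm
  · simp [hm]
  · have h2 : (((t : ℝ) + 1) / (t + 2)) ^ m ≤ ((t : ℝ) + 1) / (t + 2) :=
      pow_le_of_le_one hq0 hq1 hm
    have h3 : 1 / ((t : ℝ) + 1) ≤ 2 * (1 - ((t : ℝ) + 1) / (t + 2)) := by
      have e : 2 * (1 - ((t : ℝ) + 1) / (t + 2)) = 2 / (t + 2) := by field_simp; ring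
      rw [e, div_le_div_iff₀ (by positivity) (by positivity)]
      linarith [(Nat.cast_nonneg t : (0 : ℝ) ≤ t)]
    have h4 : 0 ≤ 1 - p₀ := sub_nonneg.2 h₀.2
    nlinarith

/-- The harmonic sum `∑_{t<n} 1/(t+1)`. -/
def harm (n : ℕ) : ℝ := ∑ t ∈ Finset.range n, 1 / ((t : ℝ) + 1)

lemma harm_nonneg (n : ℕ) : 0 ≤ harm n := Finset.sum_nonneg fun i _ => by positivity

lemma harm_le (n : ℕ) : harm n ≤ n := by
  have : ∀ i ∈ Finset.range n, 1 / ((i : ℝ) + 1) ≤ 1 := fun i _ =>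
    (div_le_one (by positivity)).2 (by linarith [(Nat.cast_nonneg i : (0 : ℝ) ≤ i)])
  simpa [harm] using Finset.sum_le_card_nsmul _ _ _ this

/-- A bounded Lyapunov function for the backward branching process of left steps; the parameter
`d` is the probability that the first coin of the row on which the process sits fails. -/
def lyap (n : ℕ) (d : ℝ) (m : ℕ) : ℝ :=
  ∑ t ∈ Finset.range n, truncId t m - n * truncId (4 * n) m - harm n * d * if m = 0 then 0 else 1

lemma abs_lyap_le (n : ℕ) {d : ℝ} (hd : d ∈ Icc (0 : ℝ) 1) (m : ℕ) :
    |lyap n d m| ≤ 5 * n ^ 2 + 2 * n + 1 := by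
  have h1 : ∑ t ∈ Finset.range n, truncId t m ≤ n * n := by
    have : ∀ t ∈ Finset.range n, truncId t m ≤ n := fun t ht =>
      (truncId_le_height t m).trans (by exact_mod_cast Finset.mem_range.1 ht)
    simpa using Finset.sum_le_card_nsmul _ _ _ this
  have h2 : 0 ≤ ∑ t ∈ Finset.range n, truncId t m :=
    Finset.sum_nonneg fun t _ => truncId_nonneg t m
  have hn : (0 : ℝ) ≤ n := Nat.cast_nonneg n
  have h3 : n * truncId (4 * n) m ≤ n * (4 * n + 1) :=
    mul_le_mul_of_nonneg_left (by simpa using truncId_le_height (4 * n) m) hn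
  have h4 : 0 ≤ n * truncId (4 * n) m := mul_nonneg hn (truncId_nonneg _ _)
  have h5 : harm n * d ≤ n := (mul_le_of_le_one_right (harm_nonneg n) hd.2).trans (harm_le n)
  have h6 : 0 ≤ harm n * d := mul_nonneg (harm_nonneg n) hd.1
  rw [lyap, abs_le]
  split_ifs <;> constructor <;> nlinarith

lemma hasSum_lyap_le {p : ℕ → ℝ} (hp : ∀ i, p i ∈ Icc (0 : ℝ) 1)
    (hp2 : ∀ i, 2 ≤ i → p i = 1 / 2) (n : ℕ) {d : ℝ} (hd : 0 ≤ d) (m : ℕ) :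
    ∃ V, HasSum (fun l => failProb p (m + 1) l * lyap n d l) V ∧
      V ≤ lyap n (1 - p 0) m + 2 * m + 1 - harm n * (d * (1 - p 0)) := by
  have hpos : HasSum (fun l => failProb p (m + 1) l * if l = 0 then (0 : ℝ) else 1)
      (1 - failProb p (m + 1) 0) := by
    have h1 : HasSum (fun l => if l = 0 then failProb p (m + 1) 0 else 0)
        (failProb p (m + 1) 0) := hasSum_ite_eq 0 _
    have h := (hasSum_failProb_one hp2 m).sub h1
    have e : (fun l => failProb p (m + 1) l * if l = 0 then (0 : ℝ) else 1) = fun l =>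
        failProb p (m + 1) l - if l = 0 then failProb p (m + 1) 0 else 0 := by
      funext l
      split_ifs with hl <;> simp [hl]
    rw [e]
    exact h
  have hs := hasSum_sum (s := Finset.range n)
    fun t _ => hasSum_failProb_truncId hp2 t m
  have hV := (hs.sub ((hasSum_failProb_truncId hp2 (4 * n) m).mul_left (n : ℝ))).sub
    (hpos.mul_left (harm n * d))
  have e : (fun l => failProb p (m + 1) l * lyap n d l) = fun l =>
      ∑ t ∈ Finset.range n, failProb p (m + 1) l * truncId t l -
        n * (failProb p (m + 1) l * truncId (4 * n) l) -
        harm n * d * (failProb p (m + 1) l * if l = 0 then (0 : ℝ) else 1) := by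
    funext l
    rw [lyap, ← Finset.mul_sum]
    ring
  rw [← e] at hV
  refine ⟨_, hV, ?_⟩
  have hlow : harm n * ((1 - p 0) * if m = 0 then 0 else 1) ≤
      ∑ t ∈ Finset.range n, truncErr (p 0) (p 1) t m := by
    rw [harm, Finset.sum_mul]
    exact Finset.sum_le_sum fun t _ => le_truncErr (hp 0) (hp 1) t m
  have hup : n * truncErr (p 0) (p 1) (4 * n) m ≤ m + 1 := by
    have h1 := mul_le_mul_of_nonneg_left (truncErr_le (hp 0) (hp 1) (4 * n) m)
      (Nat.cast_nonneg n : (0 : ℝ) ≤ n)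
    refine h1.trans ?_
    push_cast
    rw [mul_div_assoc', div_le_iff₀ (by positivity)]
    have : (0 : ℝ) ≤ m := Nat.cast_nonneg m
    nlinarith
  have htel : ∑ t ∈ Finset.range n, truncId (t + 1) m =
      ∑ t ∈ Finset.range n, truncId t m + truncId n m - truncId 0 m := by
    have := Finset.sum_range_sub (fun t => truncId t m) n
    rw [Finset.sum_sub_distrib] at this
    linarith
  have h0 := truncId_nonneg 0 m
  have h1 := truncId_le n m
  have h2 := mul_le_mul_of_nonneg_left (truncId_le_succ (4 * n) m)
    (Nat.cast_nonneg n : (0 : ℝ) ≤ n)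
  have h3 : harm n * d * (1 - p 0) ≤ harm n * d * (1 - failProb p (m + 1) 0) :=
    mul_le_mul_of_nonneg_left (by linarith [failProb_succ_zero_le hp m])
      (mul_nonneg (harm_nonneg n) hd)
  simp only [Finset.sum_sub_distrib, Finset.sum_const, Finset.card_range, nsmul_eq_mul]
  rw [htel, lyap]
  linarith

/-- Exponential tilting of a bounded function under a probability distribution on `ℕ`. -/
lemma sum_mul_exp_le {K h : ℕ → ℝ} {B V c r : ℝ} (hK : ∀ l, 0 ≤ K l) (hK1 : HasSum K 1)
    (hV : HasSum (fun l => K l * h l) V) (hc : V ≤ c) (hB : ∀ l, |h l| ≤ B) (hr : 0 ≤ r)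
    (hrB : r * (2 * B) ≤ 1) (M : ℕ) :
    ∑ l ∈ Finset.range M, K l * Real.exp (r * (h l - c)) ≤ Real.exp ((r * (2 * B)) ^ 2) := by
  have hVB : |V| ≤ B := by
    rw [abs_le]
    constructor
    · have := hasSum_le (fun l => ?_) (hK1.mul_right (-B)) hV
      · simpa using this
      · exact mul_le_mul_of_nonneg_left (abs_le.1 (hB l)).1 (hK l)
    · have := hasSum_le (fun l => ?_) hV (hK1.mul_right B)
      · simpa using this
      · exact mul_le_mul_of_nonneg_left (abs_le.1 (hB l)).2 (hK l)
  have hpt : ∀ l, K l * Real.exp (r * (h l - c)) ≤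
      K l * (1 - r * V + (r * (2 * B)) ^ 2) + r * (K l * h l) := by
    intro l
    have h1 : Real.exp (r * (h l - c)) ≤ Real.exp (r * (h l - V)) :=
      Real.exp_le_exp.2 (mul_le_mul_of_nonneg_left (by linarith) hr)
    have hd : |h l - V| ≤ 2 * B := (abs_sub _ _).trans (by linarith [hB l])
    have h2 : |r * (h l - V)| ≤ r * (2 * B) := by
      rw [abs_mul, abs_of_nonneg hr]
      exact mul_le_mul_of_nonneg_left hd hr
    have h3 := (abs_le.1 (Real.abs_exp_sub_one_sub_id_le (h2.trans hrB))).2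
    have h4 : (r * (h l - V)) ^ 2 ≤ (r * (2 * B)) ^ 2 := by
      rw [← sq_abs (r * (h l - V))]
      exact pow_le_pow_left₀ (abs_nonneg _) h2 2
    have h5 : Real.exp (r * (h l - c)) ≤ 1 - r * V + (r * (2 * B)) ^ 2 + r * h l := by linarith
    have := mul_le_mul_of_nonneg_left h5 (hK l)
    linarith
  have hsum := (hK1.mul_right (1 - r * V + (r * (2 * B)) ^ 2)).add (hV.mul_left r)
  have h1 := (Finset.sum_le_sum fun l (_ : l ∈ Finset.range M) => hpt l).trans
    (sum_le_hasSum _ (fun l _ => (mul_nonneg (hK l) (Real.exp_pos _).le).trans (hpt l)) hsum)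
  linarith [Real.add_one_le_exp ((r * (2 * B)) ^ 2)]

/-- The number of steps from `z` to `z - 1` made by the path `Y` before time `t`. -/
def leftCount (Y : ℕ → ℤ) (z : ℤ) (t : ℕ) : ℕ :=
  ∑ i ∈ Finset.range t, if Y i = z ∧ Y (i + 1) = z - 1 then 1 else 0

/-- The number of visits of the path `Y` to `z` before time `t`. -/
def visitCount (Y : ℕ → ℤ) (z : ℤ) (t : ℕ) : ℕ :=
  ∑ i ∈ Finset.range t, if Y i = z then 1 else 0

/-- The paths that coincide with `x` up to time `n`. -/
def pathCyl (x : ℕ → ℤ) (n : ℕ) : Set (ℕ → ℤ) := {Y | ∀ m ≤ n, Y m = x m}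

/-- The path that follows `x` up to time `m` and moves to `y` at time `m + 1`. -/
abbrev extendPath (x : ℕ → ℤ) (m : ℕ) (y : ℤ) : ℕ → ℤ := Function.update x (m + 1) y

lemma extendPath_of_le (x : ℕ → ℤ) {m i : ℕ} (y : ℤ) (h : i ≤ m) : extendPath x m y i = x i :=
  Function.update_of_ne (by omega) _ _

lemma extendPath_succ (x : ℕ → ℤ) (m : ℕ) (y : ℤ) : extendPath x m y (m + 1) = y :=
  Function.update_self _ _ _

lemma leftCount_congr {x y : ℕ → ℤ} {t : ℕ} (h : ∀ i ≤ t, x i = y i) (z : ℤ) :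
    leftCount x z t = leftCount y z t := by
  refine Finset.sum_congr rfl fun i hi => ?_
  have hi := Finset.mem_range.1 hi
  rw [h i (by omega), h (i + 1) (by omega)]

lemma leftCount_mono (x : ℕ → ℤ) (z : ℤ) : Monotone (leftCount x z) := fun _ _ h =>
  Finset.sum_le_sum_of_subset (Finset.range_mono h)

lemma leftCount_extendPath (x : ℕ → ℤ) (m : ℕ) (y z : ℤ) :
    leftCount (extendPath x m y) z (m + 1) =
      leftCount x z m + if x m = z ∧ y = z - 1 then 1 else 0 := by
  rw [leftCount, Finset.sum_range_succ, extendPath_succ, extendPath_of_le x y le_rfl]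
  congr 1
  exact leftCount_congr (fun i hi => extendPath_of_le x y hi) z

lemma visitCount_extendPath (x : ℕ → ℤ) (m : ℕ) (y z : ℤ) :
    visitCount (extendPath x m y) z (m + 1) = visitCount x z m + if x m = z then 1 else 0 := by
  rw [visitCount, Finset.sum_range_succ, extendPath_of_le x y le_rfl]
  congr 1
  refine Finset.sum_congr rfl fun i hi => ?_
  rw [extendPath_of_le x y (Finset.mem_range.1 hi).le]

lemma prevVisits_eq (x : ℕ → ℤ) (n : ℕ) : prevVisits x n = visitCount x (x n) n := by
  rw [prevVisits, visitCount, Finset.card_filter]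

lemma stepProb_congr (ω : CEnv) {x y : ℕ → ℤ} {n : ℕ} (h : ∀ i ≤ n + 1, x i = y i) :
    stepProb ω x n = stepProb ω y n := by
  have hv : prevVisits x n = prevVisits y n := by
    rw [prevVisits_eq, prevVisits_eq, h n (by omega)]
    refine Finset.sum_congr rfl fun i hi => ?_
    rw [h i (by have := Finset.mem_range.1 hi; omega)]
  rw [stepProb, stepProb, hv, h n (by omega), h (n + 1) le_rfl]

lemma cylProb_extendPath (ω : CEnv) (x0 : ℤ) (x : ℕ → ℤ) (m : ℕ) (y : ℤ) :
    cylProb ω x0 (extendPath x m y) (m + 1) =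
      cylProb ω x0 x m * stepProb ω (extendPath x m y) m := by
  rw [cylProb, cylProb, Finset.prod_range_succ, extendPath_of_le x y (Nat.zero_le _), mul_assoc]
  congr 2
  refine Finset.prod_congr rfl fun i hi => stepProb_congr ω fun j hj => extendPath_of_le x y ?_
  have := Finset.mem_range.1 hi
  omega

lemma cylProb_right (ω : CEnv) (x0 : ℤ) (x : ℕ → ℤ) (m : ℕ) :
    cylProb ω x0 (extendPath x m (x m + 1)) (m + 1) =
      cylProb ω x0 x m * ω (x m) (visitCount x (x m) m) := by
  rw [cylProb_extendPath, stepProb, prevVisits_eq, extendPath_succ, extendPath_of_le x _ le_rfl,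
    if_pos rfl]
  congr 2
  exact Finset.sum_congr rfl fun i hi => by
    rw [extendPath_of_le x _ (Finset.mem_range.1 hi).le]

lemma cylProb_left (ω : CEnv) (x0 : ℤ) (x : ℕ → ℤ) (m : ℕ) :
    cylProb ω x0 (extendPath x m (x m - 1)) (m + 1) =
      cylProb ω x0 x m * (1 - ω (x m) (visitCount x (x m) m)) := by
  rw [cylProb_extendPath, stepProb, prevVisits_eq, extendPath_succ, extendPath_of_le x _ le_rfl,
    if_neg (by omega), if_pos rfl]
  congr 3
  exact Finset.sum_congr rfl fun i hi => by
    rw [extendPath_of_le x _ (Finset.mem_range.1 hi).le]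

lemma IsCookieEnv.mem_Icc {ω : CEnv} (hω : IsCookieEnv ω) (z : ℤ) (i : ℕ) :
    ω z i ∈ Icc (0 : ℝ) 1 := ⟨by linarith [(hω z i).1], (hω z i).2⟩

lemma cylProb_nonneg {ω : CEnv} (hω : IsCookieEnv ω) (x0 : ℤ) (x : ℕ → ℤ) (n : ℕ) :
    0 ≤ cylProb ω x0 x n := by
  refine mul_nonneg (by split_ifs <;> norm_num) (Finset.prod_nonneg fun m _ => ?_)
  have := hω.mem_Icc (x m) (prevVisits x m)
  rw [stepProb]
  split_ifs
  · exact this.1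
  · exact sub_nonneg.2 this.2
  · exact le_rfl

lemma IsERWLaw.real_pathCyl {ω : CEnv} (hω : IsCookieEnv ω) {x0 : ℤ} {P : Measure (ℕ → ℤ)}
    (hP : IsERWLaw ω x0 P) (x : ℕ → ℤ) (n : ℕ) : P.real (pathCyl x n) = cylProb ω x0 x n := by
  rw [Measure.real, pathCyl, hP.2 x n, ENNReal.toReal_ofReal (cylProb_nonneg hω _ _ _)]

lemma measurableSet_pathCyl (x : ℕ → ℤ) (n : ℕ) : MeasurableSet (pathCyl x n) := by
  have : pathCyl x n = ⋂ m : ℕ, ⋂ _ : m ≤ n, {Y : ℕ → ℤ | Y m = x m} := by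
    ext Y; simp [pathCyl]
  rw [this]
  exact MeasurableSet.iInter fun m => MeasurableSet.iInter fun _ =>
    measurableSet_eq_fun (measurable_pi_apply m) measurable_const

lemma pathCyl_extendPath_subset (x : ℕ → ℤ) (m : ℕ) (y : ℤ) :
    pathCyl (extendPath x m y) (m + 1) ⊆ pathCyl x m := fun Y hY i hi => by
  rw [hY i (by omega), extendPath_of_le x y hi]

/-- The walk almost surely makes nearest-neighbour steps. -/
lemma IsERWLaw.real_pathCyl_inter_le {ω : CEnv} (hω : IsCookieEnv ω) {x0 : ℤ}
    {P : Measure (ℕ → ℤ)} (hP : IsERWLaw ω x0 P) (x : ℕ → ℤ) (m : ℕ) (A : Set (ℕ → ℤ)) :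
    P.real (pathCyl x m ∩ A) ≤ P.real (pathCyl (extendPath x m (x m + 1)) (m + 1) ∩ A) +
      P.real (pathCyl (extendPath x m (x m - 1)) (m + 1) ∩ A) := by
  have := hP.1
  set C₁ := pathCyl (extendPath x m (x m + 1)) (m + 1)
  set C₂ := pathCyl (extendPath x m (x m - 1)) (m + 1)
  have hdisj : Disjoint C₁ C₂ := by
    rw [Set.disjoint_left]
    intro Y h1 h2
    have e1 := h1 (m + 1) le_rfl
    have e2 := h2 (m + 1) le_rfl
    rw [extendPath_succ] at e1 e2
    omega
  have hm1 : MeasurableSet C₁ := measurableSet_pathCyl _ _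
  have hm2 : MeasurableSet C₂ := measurableSet_pathCyl _ _
  have hnull : P.real (pathCyl x m \ (C₁ ∪ C₂)) = 0 := by
    rw [measureReal_sdiff (union_subset (pathCyl_extendPath_subset _ _ _)
      (pathCyl_extendPath_subset _ _ _)) (hm1.union hm2), measureReal_union hdisj hm2,
      hP.real_pathCyl hω, hP.real_pathCyl hω, hP.real_pathCyl hω, cylProb_right, cylProb_left]
    ring
  have hsub : pathCyl x m ∩ A ⊆ (C₁ ∩ A) ∪ (C₂ ∩ A) ∪ (pathCyl x m \ (C₁ ∪ C₂)) := by
    intro Y hY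
    by_cases h1 : Y ∈ C₁
    · exact Or.inl (Or.inl ⟨h1, hY.2⟩)
    by_cases h2 : Y ∈ C₂
    · exact Or.inl (Or.inr ⟨h2, hY.2⟩)
    · exact Or.inr ⟨hY.1, fun h => h.elim h1 h2⟩
  have h1 := measureReal_mono (μ := P) hsub
  have h2 := measureReal_union_le (μ := P) ((C₁ ∩ A) ∪ (C₂ ∩ A)) (pathCyl x m \ (C₁ ∪ C₂))
  have h3 := measureReal_union_le (μ := P) (C₁ ∩ A) (C₂ ∩ A)
  linarith

/-- Chernoff bound for the walk lying far to the left, conditionally on an initial segment. -/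
lemma IsERWLaw.real_pathCyl_inter_left_le {ω : CEnv} (hω : IsCookieEnv ω) {x0 : ℤ}
    {P : Measure (ℕ → ℤ)} (hP : IsERWLaw ω x0 P) {r : ℝ} (hr : 0 ≤ r) (a : ℝ) (j m : ℕ)
    (x : ℕ → ℤ) :
    P.real (pathCyl x m ∩ {Y | (Y (m + j) : ℝ) ≤ -a}) ≤
      cylProb ω x0 x m * (Real.cosh r ^ j * Real.exp (r * (-a - x m))) := by
  have := hP.1
  induction j generalizing m x with
  | zero =>
    by_cases h : (x m : ℝ) ≤ -a
    · have h1 := measureReal_mono (μ := P)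
        (inter_subset_left : pathCyl x m ∩ {Y | (Y (m + 0) : ℝ) ≤ -a} ⊆ _)
      rw [hP.real_pathCyl hω] at h1
      refine h1.trans (le_mul_of_one_le_right (cylProb_nonneg hω _ _ _) ?_)
      rw [pow_zero, one_mul]
      exact Real.one_le_exp (mul_nonneg hr (by linarith))
    · have : pathCyl x m ∩ {Y | (Y (m + 0) : ℝ) ≤ -a} = ∅ := by
        ext Y
        simp only [mem_inter_iff, add_zero, mem_empty_iff_false, iff_false, not_and]
        intro h1 h2
        rw [mem_ofPred_eq, h1 m le_rfl] at h2
        exact h h2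
      rw [this, measureReal_empty]
      exact mul_nonneg (cylProb_nonneg hω _ _ _) (mul_nonneg
        (pow_nonneg (Real.cosh_pos _).le _) (Real.exp_pos _).le)
  | succ j ih =>
    have h1 := hP.real_pathCyl_inter_le hω x m {Y | (Y (m + (j + 1)) : ℝ) ≤ -a}
    have e : m + (j + 1) = m + 1 + j := by ring
    rw [e] at h1 ⊢
    have h2 := ih (m + 1) (extendPath x m (x m + 1))
    have h3 := ih (m + 1) (extendPath x m (x m - 1))
    rw [cylProb_right, extendPath_succ] at h2
    rw [cylProb_left, extendPath_succ] at h3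
    refine (h1.trans (add_le_add h2 h3)).trans ?_
    have e1 : Real.exp (r * (-a - ((x m + 1 : ℤ) : ℝ))) =
        Real.exp (r * (-a - x m)) * Real.exp (-r) := by
      rw [← Real.exp_add]; congr 1; push_cast; ring
    have e2 : Real.exp (r * (-a - ((x m - 1 : ℤ) : ℝ))) =
        Real.exp (r * (-a - x m)) * Real.exp r := by
      rw [← Real.exp_add]; congr 1; push_cast; ring
    rw [e1, e2, pow_succ]
    have hw := (hω (x m) (visitCount x (x m) m)).1
    generalize ω (x m) (visitCount x (x m) m) = q at *
    have hexp : Real.exp (-r) ≤ Real.exp r := Real.exp_le_exp.2 (by linarith)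
    have hq : q * Real.exp (-r) + (1 - q) * Real.exp r ≤ Real.cosh r := by
      rw [Real.cosh_eq]
      nlinarith
    have hc := mul_nonneg (cylProb_nonneg hω x0 x m) (mul_nonneg
      (pow_nonneg (Real.cosh_pos r).le j) (Real.exp_pos (r * (-a - x m))).le)
    have := mul_le_mul_of_nonneg_left hq hc
    linarith

/-- The event that the walk reaches `k` by time `n` and has made, when it first does so, exactly
`w z` left steps from each site `0 ≤ z < k`. -/
def hitEvent (k : ℕ) (w : ℕ → ℕ) (n : ℕ) : Set (ℕ → ℤ) :=
  {Y | ∃ t ≤ n, Y t = k ∧ (∀ i < t, Y i ≠ k) ∧ ∀ z < k, leftCount Y z t = w z}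

/-- The probability that the coins left over after the path `x` up to time `m` produce exactly the
missing left steps, each row being stopped after the missing right steps. -/
def restProb (ω : CEnv) (k : ℕ) (w : ℕ → ℕ) (x : ℕ → ℤ) (m : ℕ) : ℝ :=
  ∏ z ∈ Finset.range k, failProb (fun i => ω z (visitCount x z m + i))
    (w (z + 1) - leftCount x ((z + 1 : ℕ) : ℤ) m + if x m ≤ (z : ℤ) then 1 else 0)
    (w z - leftCount x z m)

lemma restProb_nonneg {ω : CEnv} (hω : IsCookieEnv ω) (k : ℕ) (w : ℕ → ℕ) (x : ℕ → ℤ) (m : ℕ) :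
    0 ≤ restProb ω k w x m :=
  Finset.prod_nonneg fun _ _ => failProb_nonneg (fun _ => hω.mem_Icc _ _) _ _

lemma restProb_of_neg (ω : CEnv) (k : ℕ) (w : ℕ → ℕ) (x : ℕ → ℤ) (m : ℕ) (hx : x m < 0) {y : ℤ}
    (hy : y ≤ 0) : restProb ω k w (extendPath x m y) (m + 1) = restProb ω k w x m := by
  refine Finset.prod_congr rfl fun z _ => ?_
  rw [visitCount_extendPath, leftCount_extendPath, leftCount_extendPath, extendPath_succ,
    if_neg (show ¬x m = (z : ℤ) by omega),
    if_neg (show ¬(x m = ((z + 1 : ℕ) : ℤ) ∧ y = ((z + 1 : ℕ) : ℤ) - 1) by omega),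
    if_neg (show ¬(x m = (z : ℤ) ∧ y = (z : ℤ) - 1) by omega),
    if_pos (show y ≤ (z : ℤ) by omega), if_pos (show x m ≤ (z : ℤ) by omega)]
  simp

lemma restProb_of_nonneg (ω : CEnv) (k : ℕ) (w : ℕ → ℕ) (x : ℕ → ℤ) (m : ℕ) {z₀ : ℕ}
    (hx : x m = z₀) (hz : z₀ < k) (hL : leftCount x z₀ m ≤ w z₀) :
    restProb ω k w x m =
      ω (x m) (visitCount x (x m) m) * restProb ω k w (extendPath x m (x m + 1)) (m + 1) +
      (1 - ω (x m) (visitCount x (x m) m)) * if leftCount x z₀ m = w z₀ then 0 else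
        restProb ω k w (extendPath x m (x m - 1)) (m + 1) := by
  have hmem := Finset.mem_range.2 hz
  simp only [restProb]
  rw [← Finset.mul_prod_erase _ _ hmem, ← Finset.mul_prod_erase _ _ hmem,
    ← Finset.mul_prod_erase _ _ hmem]
  simp only [visitCount_extendPath, leftCount_extendPath, extendPath_succ, hx]
  set R := ∏ z ∈ (Finset.range k).erase z₀, failProb (fun i => ω z (visitCount x z m + i))
    (w (z + 1) - leftCount x ((z + 1 : ℕ) : ℤ) m + if (z₀ : ℤ) ≤ (z : ℤ) then 1 else 0)
    (w z - leftCount x z m) with hR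
  have hright : ∏ z ∈ (Finset.range k).erase z₀,
      failProb (fun i => ω z (visitCount x z m + (if (z₀ : ℤ) = z then 1 else 0) + i))
      (w (z + 1) - (leftCount x ((z + 1 : ℕ) : ℤ) m +
        if (z₀ : ℤ) = ((z + 1 : ℕ) : ℤ) ∧ (z₀ : ℤ) + 1 = ((z + 1 : ℕ) : ℤ) - 1 then 1 else 0) +
        if (z₀ : ℤ) + 1 ≤ (z : ℤ) then 1 else 0)
      (w z - (leftCount x z m + if (z₀ : ℤ) = z ∧ (z₀ : ℤ) + 1 = z - 1 then 1 else 0)) = R := by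
    refine Finset.prod_congr rfl fun z hz' => ?_
    have hne : z ≠ z₀ := Finset.ne_of_mem_erase hz'
    rw [if_neg (show ¬(z₀ : ℤ) = z by omega),
      if_neg (show ¬((z₀ : ℤ) = ((z + 1 : ℕ) : ℤ) ∧ (z₀ : ℤ) + 1 = ((z + 1 : ℕ) : ℤ) - 1) by omega),
      if_neg (show ¬((z₀ : ℤ) = z ∧ (z₀ : ℤ) + 1 = (z : ℤ) - 1) by omega)]
    simp only [add_zero]
    congr 2
    split_ifs <;> omega
  rw [hright]
  rw [if_neg (show ¬((z₀ : ℤ) = ((z₀ + 1 : ℕ) : ℤ) ∧ (z₀ : ℤ) + 1 = ((z₀ + 1 : ℕ) : ℤ) - 1) by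
      omega), if_neg (show ¬(z₀ : ℤ) + 1 ≤ z₀ by omega),
    if_neg (show ¬(True ∧ (z₀ : ℤ) + 1 = (z₀ : ℤ) - 1) by omega),
    if_neg (show ¬((z₀ : ℤ) = ((z₀ + 1 : ℕ) : ℤ) ∧ (z₀ : ℤ) - 1 = ((z₀ + 1 : ℕ) : ℤ) - 1) by
      omega), if_pos (le_refl (z₀ : ℤ)), if_pos (show (z₀ : ℤ) - 1 ≤ z₀ by omega),
    if_pos True.intro, if_pos (And.intro True.intro True.intro)]
  simp only [add_zero]
  have hq : (fun i => ω z₀ (visitCount x z₀ m + (i + 1))) =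
      fun i => ω z₀ (visitCount x z₀ m + 1 + i) := by
    funext i
    rw [add_assoc, add_comm 1 i]
  rcases Nat.eq_or_lt_of_le hL with heq | hlt
  · rw [if_pos heq, heq, Nat.sub_self, failProb]
    simp only [add_zero]
    rw [hq]
    ring
  · rw [if_neg hlt.ne]
    obtain ⟨b, hb⟩ : ∃ b, w z₀ = leftCount x z₀ m + b + 1 := ⟨w z₀ - leftCount x z₀ m - 1, by omega⟩
    have hleft : ∏ z ∈ (Finset.range k).erase z₀,
        failProb (fun i => ω z (visitCount x z m + (if (z₀ : ℤ) = z then 1 else 0) + i))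
        (w (z + 1) - (leftCount x ((z + 1 : ℕ) : ℤ) m +
          if (z₀ : ℤ) = ((z + 1 : ℕ) : ℤ) ∧ (z₀ : ℤ) - 1 = ((z + 1 : ℕ) : ℤ) - 1 then 1 else 0) +
          if (z₀ : ℤ) - 1 ≤ (z : ℤ) then 1 else 0)
        (w z - (leftCount x z m + if (z₀ : ℤ) = z ∧ (z₀ : ℤ) - 1 = z - 1 then 1 else 0)) = R := by
      refine Finset.prod_congr rfl fun z hz' => ?_
      have hne : z ≠ z₀ := Finset.ne_of_mem_erase hz'
      rw [if_neg (show ¬(z₀ : ℤ) = z by omega), if_neg (show ¬((z₀ : ℤ) = z ∧ _) by omega)]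
      simp only [add_zero]
      congr 1
      by_cases h1 : z₀ = z + 1
      · subst h1
        rw [if_pos (by simp), if_pos (by push_cast; omega), if_neg (by push_cast; omega)]
        omega
      · rw [if_neg (by omega)]
        split_ifs <;> omega
    rw [hleft, show w z₀ - leftCount x z₀ m = b + 1 by omega,
      show w z₀ - (leftCount x z₀ m + 1) = b by omega, failProb]
    simp only [add_zero]
    rw [hq]
    ring

lemma pathCyl_inter_hitEvent_eq_empty {x : ℕ → ℤ} {m k : ℕ} {w : ℕ → ℕ} {n : ℕ}
    (h : ∀ t ≤ n, ∀ Y ∈ pathCyl x m, Y t = k → (∀ i < t, Y i ≠ k) →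
      (∀ z < k, leftCount Y z t = w z) → False) : pathCyl x m ∩ hitEvent k w n = ∅ :=
  eq_empty_of_forall_notMem fun Y ⟨hY, t, ht, h1, h2, h3⟩ => h t ht Y hY h1 h2 h3

lemma restProb_eq_one {ω : CEnv} {k : ℕ} {w : ℕ → ℕ} {x : ℕ → ℤ} {m : ℕ} (hwk : w k = 0)
    (hx : x m = k) (hL : ∀ z < k, leftCount x z m = w z) : restProb ω k w x m = 1 := by
  refine Finset.prod_eq_one fun z hz => ?_
  have hz := Finset.mem_range.1 hz
  rw [hL z hz, Nat.sub_self, if_neg (show ¬x m ≤ (z : ℤ) by omega)]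
  have : w (z + 1) - leftCount x ((z + 1 : ℕ) : ℤ) m = 0 := by
    rcases Nat.lt_or_ge (z + 1) k with h | h
    · rw [hL _ h, Nat.sub_self]
    · rw [show z + 1 = k by omega, hwk, Nat.zero_sub]
  rw [this, failProb]

lemma IsERWLaw.real_pathCyl_inter_hitEvent_le {ω : CEnv} (hω : IsCookieEnv ω)
    {P : Measure (ℕ → ℤ)} (hP : IsERWLaw ω 0 P) {k : ℕ} {w : ℕ → ℕ} (hwk : w k = 0) (j m : ℕ)
    (x : ℕ → ℤ) (hne : ∀ i < m, x i ≠ k) (hle : x m ≤ k) (hL : ∀ z < k, leftCount x z m ≤ w z) :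
    P.real (pathCyl x m ∩ hitEvent k w (m + j)) ≤ cylProb ω 0 x m * restProb ω k w x m := by
  have := hP.1
  have hpos : ∀ m x, 0 ≤ cylProb ω 0 x m * restProb ω k w x m := fun m x =>
    mul_nonneg (cylProb_nonneg hω _ _ _) (restProb_nonneg hω _ _ _ _)
  induction j generalizing m x with
  | zero =>
    by_cases hxk : x m = k
    · by_cases hall : ∀ z < k, leftCount x z m = w z
      · rw [restProb_eq_one hwk hxk hall, mul_one, ← hP.real_pathCyl hω]
        exact measureReal_mono inter_subset_left
      · rw [pathCyl_inter_hitEvent_eq_empty, measureReal_empty]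
        · exact hpos m x
        · intro t ht Y hY h1 h2 h3
          have htm : t = m := by
            by_contra hne'
            exact hne t (by omega) (by rw [← hY t ht, h1])
          subst htm
          exact hall fun z hz => by rw [← h3 z hz, leftCount_congr fun i hi => (hY i hi).symm]
    · rw [pathCyl_inter_hitEvent_eq_empty, measureReal_empty]
      · exact hpos m x
      · intro t ht Y hY h1 _ _
        rw [hY t ht] at h1
        rcases Nat.lt_or_ge t m with h | h
        · exact hne t h h1
        · exact hxk (by rwa [show m = t by omega])
  | succ j ih =>
    by_cases hxk : x m = k
    · refine le_trans (measureReal_mono ?_) (ih m x hne hle hL)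
      rintro Y ⟨hY, t, ht, h1, h2, h3⟩
      refine ⟨hY, t, ?_, h1, h2, h3⟩
      by_contra hlt
      exact h2 m (by omega) (by rw [hY m le_rfl, hxk])
    have h0 := hP.real_pathCyl_inter_le hω x m (hitEvent k w (m + (j + 1)))
    rw [show m + (j + 1) = m + 1 + j by ring] at h0 ⊢
    refine h0.trans ?_
    have hne' : ∀ y, ∀ i < m + 1, extendPath x m y i ≠ k := fun y i hi => by
      rw [extendPath_of_le x y (by omega)]
      rcases Nat.lt_or_ge i m with h | h
      · exact hne i h
      · rwa [show i = m by omega]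
    have hright := ih (m + 1) (extendPath x m (x m + 1)) (hne' _)
      (by rw [extendPath_succ]; omega) fun z hz => by
        rw [leftCount_extendPath, if_neg (by omega), add_zero]
        exact hL z hz
    rw [cylProb_right] at hright
    have hleft := ih (m + 1) (extendPath x m (x m - 1)) (hne' _) (by rw [extendPath_succ]; omega)
    rw [cylProb_left] at hleft
    rcases lt_or_ge (x m) 0 with hneg | hnn
    · have hleft := hleft fun z hz => by
        rw [leftCount_extendPath, if_neg (by omega), add_zero]
        exact hL z hz
      rw [restProb_of_neg ω k w x m hneg (by omega)] at hleft hright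
      linarith
    · obtain ⟨z₀, hz₀⟩ := Int.eq_ofNat_of_zero_le hnn
      have hz₀k : z₀ < k := by omega
      rw [restProb_of_nonneg ω k w x m hz₀ hz₀k (hL z₀ hz₀k)]
      have hleft' : P.real (pathCyl (extendPath x m (x m - 1)) (m + 1) ∩
          hitEvent k w (m + 1 + j)) ≤
          cylProb ω 0 x m * (1 - ω (x m) (visitCount x (x m) m)) *
            if leftCount x z₀ m = w z₀ then 0 else
              restProb ω k w (extendPath x m (x m - 1)) (m + 1) := by
        split_ifs with heq
        · rw [mul_zero, pathCyl_inter_hitEvent_eq_empty, measureReal_empty]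
          intro t _ Y hY h1 _ h3
          have htm : m + 1 ≤ t := by
            by_contra hlt
            have e := hY t (by omega)
            exact hne' _ t (by omega) (e.symm.trans h1)
          have hmono := leftCount_mono Y z₀ htm
          rw [h3 z₀ hz₀k, leftCount_congr hY, leftCount_extendPath, if_pos ⟨hz₀, by rw [hz₀]⟩,
            heq] at hmono
          omega
        · refine hleft fun z hz => ?_
          rw [leftCount_extendPath]
          split_ifs with h
          · have : z = z₀ := by omega
            subst this
            have := hL z hz
            omega
          · exact hL z hz
      linarith

lemma IsERWLaw.real_le_real_start_inter {ω : CEnv} (hω : IsCookieEnv ω) {P : Measure (ℕ → ℤ)}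
    (hP : IsERWLaw ω 0 P) (A : Set (ℕ → ℤ)) :
    P.real A ≤ P.real (pathCyl (fun _ => 0) 0 ∩ A) := by
  have := hP.1
  have hfull : P.real (pathCyl (fun _ => 0) 0) = 1 := by
    rw [hP.real_pathCyl hω]
    simp [cylProb]
  have hnull : P.real (pathCyl (fun _ => 0) 0)ᶜ = 0 := by
    rw [measureReal_compl (measurableSet_pathCyl _ _), hfull, probReal_univ, sub_self]
  calc P.real A ≤ P.real ((pathCyl (fun _ => 0) 0 ∩ A) ∪ (pathCyl (fun _ => 0) 0)ᶜ) :=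
        measureReal_mono fun Y hY => by
          by_cases hc : Y ∈ pathCyl (fun _ => 0) 0
          · exact Or.inl ⟨hc, hY⟩
          · exact Or.inr hc
    _ ≤ _ := (measureReal_union_le _ _).trans (by rw [hnull, add_zero])

/-- The probability of reaching `k` with prescribed numbers of left steps is at most the weight of
the corresponding trajectory of the branching process of left steps. -/
lemma IsERWLaw.real_hitEvent_le {ω : CEnv} (hω : IsCookieEnv ω) {P : Measure (ℕ → ℤ)}
    (hP : IsERWLaw ω 0 P) {k : ℕ} {w : ℕ → ℕ} (hwk : w k = 0) (n : ℕ) :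
    P.real (hitEvent k w n) ≤
      ∏ z ∈ Finset.range k, failProb (ω z) (w (z + 1) + 1) (w z) := by
  have h := hP.real_pathCyl_inter_hitEvent_le hω hwk n 0 (fun _ => 0) (by simp) (by simp)
    (by simp [leftCount])
  rw [zero_add] at h
  refine ((hP.real_le_real_start_inter hω _).trans h).trans (le_of_eq ?_)
  simp [cylProb, restProb, leftCount, visitCount]

/-- The sequence starting with `w` and equal to `m` from `k` on. -/
def extendSeq {k M : ℕ} (w : Fin k → Fin M) (m z : ℕ) : ℕ := if h : z < k then w ⟨z, h⟩ else m

lemma extendSeq_self {k M : ℕ} (w : Fin k → Fin M) (m : ℕ) : extendSeq w m k = m :=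
  dif_neg (lt_irrefl k)

lemma extendSeq_snoc {k M : ℕ} (w : Fin k → Fin M) (l : Fin M) (m : ℕ) {z : ℕ} (hz : z ≤ k) :
    extendSeq (Fin.snoc (α := fun _ => Fin M) w l) m z = extendSeq w l z := by
  rw [extendSeq, dif_pos (by omega), extendSeq, Fin.snoc]
  split_ifs <;> rfl

lemma sum_prod_chain_le {F : ℕ → ℕ → ℕ → ℝ} (hF : ∀ z m l, 0 ≤ F z m l) {C : ℝ} {M : ℕ}
    (hC : ∀ z m, ∑ l ∈ Finset.range M, F z m l ≤ C) (k m : ℕ) :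
    ∑ w : Fin k → Fin M, ∏ z ∈ Finset.range k, F z (extendSeq w m (z + 1)) (extendSeq w m z) ≤
      C ^ k := by
  have hC0 : 0 ≤ C := (Finset.sum_nonneg fun l _ => hF 0 0 l).trans (hC 0 0)
  induction k generalizing m with
  | zero => simp
  | succ k ih =>
    rw [← (Fin.snocEquiv fun _ : Fin (k + 1) => Fin M).sum_comp, Fintype.sum_prod_type]
    have hstep : ∀ (l : Fin M) (w : Fin k → Fin M),
        ∏ z ∈ Finset.range (k + 1),
          F z (extendSeq (Fin.snocEquiv (fun _ : Fin (k + 1) => Fin M) (l, w)) m (z + 1))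
            (extendSeq (Fin.snocEquiv (fun _ : Fin (k + 1) => Fin M) (l, w)) m z) =
        (∏ z ∈ Finset.range k, F z (extendSeq w l (z + 1)) (extendSeq w l z)) * F k m l := by
      intro l w
      have e : Fin.snocEquiv (fun _ : Fin (k + 1) => Fin M) (l, w) =
        Fin.snoc (α := fun _ => Fin M) w l := rfl
      rw [e, Finset.prod_range_succ, extendSeq_self, extendSeq_snoc _ _ _ le_rfl, extendSeq_self]
      congr 1
      refine Finset.prod_congr rfl fun z hz => ?_
      have hz := Finset.mem_range.1 hz
      rw [extendSeq_snoc _ _ _ hz, extendSeq_snoc _ _ _ hz.le]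
    simp only [hstep, ← Finset.sum_mul]
    calc _ ≤ ∑ l : Fin M, C ^ k * F k m l :=
          Finset.sum_le_sum fun l _ => mul_le_mul_of_nonneg_right (ih l) (hF _ _ _)
      _ = C ^ k * ∑ l ∈ Finset.range M, F k m l := by
          rw [← Finset.mul_sum, Finset.sum_range fun l => F k m l]
      _ ≤ C ^ (k + 1) := by
          rw [pow_succ]
          exact mul_le_mul_of_nonneg_left (hC k m) (pow_nonneg hC0 k)

lemma sum_leftCount_le (Y : ℕ → ℤ) (k t : ℕ) :
    ∑ z ∈ Finset.range k, leftCount Y z t ≤ t := by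
  simp only [leftCount]
  rw [Finset.sum_comm]
  calc _ ≤ ∑ i ∈ Finset.range t, 1 := Finset.sum_le_sum fun i _ => by
        rw [← Finset.card_filter, Finset.card_le_one]
        intro a ha b hb
        have ha := (Finset.mem_filter.1 ha).2.1
        have hb := (Finset.mem_filter.1 hb).2.1
        omega
    _ = t := by simp

lemma leftCount_le (Y : ℕ → ℤ) (z : ℤ) (t : ℕ) : leftCount Y z t ≤ t := by
  rw [leftCount, ← Finset.card_filter]
  exact (Finset.card_filter_le _ _).trans (Finset.card_range t).le

lemma exists_mem_hitEvent {Y : ℕ → ℤ} {k n : ℕ} (hY : ∃ m ≤ n, Y m = k) :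
    ∃ w : Fin k → Fin (n + 1), ∑ z ∈ Finset.range k, extendSeq w 0 z ≤ n ∧
      Y ∈ hitEvent k (extendSeq w 0) n := by
  obtain ⟨m, hm, hmk⟩ := hY
  have hex : ∃ m, Y m = k := ⟨m, hmk⟩
  classical
  set t := Nat.find hex with ht
  have htn : t ≤ n := (Nat.find_min' hex hmk).trans hm
  let w : Fin k → Fin (n + 1) := fun z =>
    ⟨leftCount Y (z : ℕ) t, Nat.lt_succ_of_le ((leftCount_le _ _ _).trans htn)⟩
  have hw : ∀ z < k, extendSeq w 0 z = leftCount Y z t := fun z hz => dif_pos hz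
  refine ⟨w, ?_, t, htn, Nat.find_spec hex, fun i hi => Nat.find_min hex hi, fun z hz =>
    (hw z hz).symm⟩
  rw [Finset.sum_congr rfl fun z hz => hw z (Finset.mem_range.1 hz)]
  exact (sum_leftCount_le _ _ _).trans htn

/-- `1 - ω (z - 1) 0` for `z ≥ 1`, and `0` for `z = 0`. -/
def prevGap (ω : CEnv) (z : ℕ) : ℝ := if z = 0 then 0 else 1 - ω ((z - 1 : ℕ) : ℤ) 0

lemma prevGap_succ (ω : CEnv) (z : ℕ) : prevGap ω (z + 1) = 1 - ω z 0 := by simp [prevGap]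

lemma IsCookieEnv.prevGap_mem_Icc {ω : CEnv} (hω : IsCookieEnv ω) (z : ℕ) :
    prevGap ω z ∈ Icc (0 : ℝ) 1 := by
  cases z with
  | zero => simp [prevGap]
  | succ z =>
    have := hω.mem_Icc z 0
    rw [prevGap_succ]
    exact ⟨by linarith [this.2], by linarith [this.1]⟩

lemma IsERWLaw.real_hit_le {ω : CEnv} (hω : IsCookieEnv ω)
    (htwo : ∀ (z : ℕ) i, 2 ≤ i → ω z i = 1 / 2) {P : Measure (ℕ → ℤ)} (hP : IsERWLaw ω 0 P)
    (N k n : ℕ) {r B : ℝ} (hr : 0 ≤ r) (hrB : r * (2 * B) ≤ 1)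
    (hB : 5 * (N : ℝ) ^ 2 + 2 * N + 1 ≤ B) :
    P.real {Y | ∃ m ≤ n, Y m = k} ≤ Real.exp ((r * (2 * B)) ^ 2 * k +
      r * (2 * B + 2 * n + k -
        harm N * ∑ z ∈ Finset.range k, prevGap ω z * prevGap ω (z + 1))) := by
  have := hP.1
  have hB0 : ∀ d ∈ Icc (0 : ℝ) 1, ∀ m, |lyap N d m| ≤ B := fun d hd m =>
    (abs_lyap_le N hd m).trans hB
  set G := ∑ z ∈ Finset.range k, prevGap ω z * prevGap ω (z + 1) with hG
  set c : ℕ → ℕ → ℝ := fun z m => lyap N (prevGap ω (z + 1)) m + 2 * m + 1 -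
    harm N * (prevGap ω z * prevGap ω (z + 1)) with hc
  set F : ℕ → ℕ → ℕ → ℝ := fun z m l => failProb (ω z) (m + 1) l *
    Real.exp (r * (lyap N (prevGap ω z) l - c z m)) with hF
  have hFp : ∀ z m l, 0 ≤ F z m l := fun z m l =>
    mul_nonneg (failProb_nonneg (fun _ => hω.mem_Icc _ _) _ _) (Real.exp_pos _).le
  have hFC : ∀ M z m, ∑ l ∈ Finset.range M, F z m l ≤ Real.exp ((r * (2 * B)) ^ 2) := by
    intro M z m
    obtain ⟨V, hV, hVc⟩ := hasSum_lyap_le (p := ω z) (fun i => hω.mem_Icc z i) (htwo z) N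
      (hω.prevGap_mem_Icc z).1 m
    rw [← prevGap_succ] at hVc
    exact sum_mul_exp_le (fun l => failProb_nonneg (fun _ => hω.mem_Icc _ _) _ _)
      (hasSum_failProb_one (htwo z) m) hV hVc (hB0 _ (hω.prevGap_mem_Icc z)) hr hrB M
  let S : Finset (Fin k → Fin (n + 1)) :=
    Finset.univ.filter fun w => ∑ z ∈ Finset.range k, extendSeq w 0 z ≤ n
  have hunion : {Y : ℕ → ℤ | ∃ m ≤ n, Y m = k} ⊆ ⋃ w ∈ S, hitEvent k (extendSeq w 0) n := by
    intro Y hY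
    obtain ⟨w, hw, hYw⟩ := exists_mem_hitEvent hY
    exact mem_iUnion₂.2 ⟨w, Finset.mem_filter.2 ⟨Finset.mem_univ _, hw⟩, hYw⟩
  have hterm : ∀ w ∈ S, P.real (hitEvent k (extendSeq w 0) n) ≤
      Real.exp (r * (2 * B + 2 * n + k - harm N * G)) *
        ∏ z ∈ Finset.range k, F z (extendSeq w 0 (z + 1)) (extendSeq w 0 z) := by
    intro w hw
    have hw := (Finset.mem_filter.1 hw).2
    refine (hP.real_hitEvent_le hω (extendSeq_self w 0) n).trans ?_
    set v := extendSeq w 0 with hv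
    have hv0 : v k = 0 := extendSeq_self w 0
    simp only [hF]
    rw [Finset.prod_mul_distrib, ← Real.exp_sum, mul_left_comm, ← Real.exp_add]
    refine le_mul_of_one_le_right (Finset.prod_nonneg fun z _ =>
      failProb_nonneg (fun _ => hω.mem_Icc _ _) _ _) (Real.one_le_exp ?_)
    rw [← Finset.mul_sum, ← mul_add]
    refine mul_nonneg hr ?_
    have hsum : ∑ z ∈ Finset.range k, (lyap N (prevGap ω z) (v z) - c z (v (z + 1))) =
        lyap N (prevGap ω 0) (v 0) - lyap N (prevGap ω k) (v k) -
          2 * (∑ z ∈ Finset.range k, (v (z + 1) : ℝ)) - k + harm N * G := by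
      rw [← Finset.sum_range_sub' fun z => lyap N (prevGap ω z) (v z), hG, Finset.mul_sum,
        Finset.mul_sum]
      have hk : (k : ℝ) = ∑ z ∈ Finset.range k, (1 : ℝ) := by simp
      rw [hk, ← Finset.sum_sub_distrib, ← Finset.sum_sub_distrib, ← Finset.sum_add_distrib]
      refine Finset.sum_congr rfl fun z _ => ?_
      simp only [hc]
      ring
    have hshift : ∑ z ∈ Finset.range k, (v (z + 1) : ℝ) ≤ n := by
      have h1 := Finset.sum_range_succ v k
      rw [Finset.sum_range_succ', hv0] at h1
      have h2 : ∑ z ∈ Finset.range k, v (z + 1) ≤ n := by omega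
      exact_mod_cast h2
    have h1 := abs_le.1 (hB0 _ (hω.prevGap_mem_Icc 0) (v 0))
    have h2 := abs_le.1 (hB0 _ (hω.prevGap_mem_Icc k) (v k))
    rw [hsum]
    linarith [h1.1, h2.2]
  calc _ ≤ P.real (⋃ w ∈ S, hitEvent k (extendSeq w 0) n) :=
        measureReal_mono hunion (measure_ne_top _ _)
    _ ≤ ∑ w ∈ S, P.real (hitEvent k (extendSeq w 0) n) := measureReal_biUnion_finset_le _ _
    _ ≤ ∑ w ∈ S, Real.exp (r * (2 * B + 2 * n + k - harm N * G)) *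
        ∏ z ∈ Finset.range k, F z (extendSeq w 0 (z + 1)) (extendSeq w 0 z) :=
          Finset.sum_le_sum hterm
    _ ≤ ∑ w, Real.exp (r * (2 * B + 2 * n + k - harm N * G)) *
        ∏ z ∈ Finset.range k, F z (extendSeq w 0 (z + 1)) (extendSeq w 0 z) :=
          Finset.sum_le_univ_sum_of_nonneg fun w =>
            mul_nonneg (Real.exp_pos _).le (Finset.prod_nonneg fun z _ => hFp _ _ _)
    _ ≤ Real.exp (r * (2 * B + 2 * n + k - harm N * G)) * Real.exp ((r * (2 * B)) ^ 2) ^ k := by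
          rw [← Finset.mul_sum]
          exact mul_le_mul_of_nonneg_left (sum_prod_chain_le hFp (hFC _) k 0) (Real.exp_pos _).le
    _ = _ := by
          rw [← Real.exp_nat_mul, ← Real.exp_add]
          congr 1
          ring

lemma eventually_of_eventually_add {p : ℕ → Prop} {n₀ : ℕ} (h : ∀ᶠ n in atTop, p (n + n₀)) :
    ∀ᶠ n in atTop, p n := by
  rw [← map_add_atTop_eq_nat n₀]
  exact h

/-- Borel–Cantelli for events of geometrically decaying probability. -/
lemma ae_eventually_notMem_of_real_le {α : Type*} [MeasurableSpace α] {μ : Measure α}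
    [IsFiniteMeasure μ] {s : ℕ → Set α} {C q : ℝ} (hq0 : 0 ≤ q) (hq1 : q < 1)
    (h : ∀ᶠ n in atTop, μ.real (s n) ≤ C * q ^ n) : ∀ᵐ x ∂μ, ∀ᶠ n in atTop, x ∉ s n := by
  obtain ⟨n₀, hn₀⟩ := eventually_atTop.1 h
  have hsum : Summable fun n => C * q ^ (n + n₀) :=
    (summable_nat_add_iff n₀).2 ((summable_geometric_of_lt_one hq0 hq1).mul_left C)
  have hfin : ∑' n, μ (s (n + n₀)) ≠ ∞ := by
    refine ne_top_of_le_ne_top hsum.tsum_ofReal_ne_top (ENNReal.tsum_le_tsum fun n => ?_)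
    rw [← ofReal_measureReal]
    exact ENNReal.ofReal_le_ofReal (hn₀ _ (Nat.le_add_left _ _))
  filter_upwards [ae_eventually_notMem hfin] with x hx
  exact eventually_of_eventually_add hx

lemma exists_le_harm (a : ℝ) : ∃ N, a ≤ harm N :=
  ((tendsto_atTop.1 Real.tendsto_sum_range_one_div_nat_succ_atTop) a).exists

lemma IsERWLaw.ae_eventually_not_hit {ω : CEnv} (hω : IsCookieEnv ω)
    (htwo : ∀ (z : ℕ) i, 2 ≤ i → ω z i = 1 / 2) {P : Measure (ℕ → ℤ)} (hP : IsERWLaw ω 0 P)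
    {γ : ℝ} (hγ : 0 < γ) (hG : ∀ᶠ n : ℕ in atTop,
      γ * n ≤ ∑ z ∈ Finset.range n, (1 - ω z 0) * (1 - ω ((z + 1 : ℕ) : ℤ) 0)) (K : ℕ) :
    ∀ᵐ Y ∂P, ∀ᶠ k : ℕ in atTop, ¬∃ m ≤ K * k, Y m = (k : ℤ) := by
  have := hP.1
  obtain ⟨N, hN⟩ := exists_le_harm ((2 * K + 3) / γ)
  rw [div_le_iff₀ hγ] at hN
  set B : ℝ := 5 * (N : ℝ) ^ 2 + 2 * N + 1 with hB
  have hB1 : 1 ≤ B := by rw [hB]; nlinarith [sq_nonneg (N : ℝ), Nat.cast_nonneg (α := ℝ) N]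
  set r : ℝ := 1 / (4 * B ^ 2) with hr
  have hr0 : 0 < r := by positivity
  have hrB : r * (2 * B) ≤ 1 := by
    rw [hr, div_mul_eq_mul_div, div_le_one (by positivity)]
    nlinarith
  have hrsq : (r * (2 * B)) ^ 2 = r := by
    rw [hr]
    field_simp
    norm_num
  have hkey : ∀ᶠ k : ℕ in atTop, P.real {Y : ℕ → ℤ | ∃ m ≤ K * (k + 1), Y m = ((k + 1 : ℕ) : ℤ)} ≤
      Real.exp (r * (2 * B + 2 * K + 2)) * Real.exp (-r) ^ k := by
    filter_upwards [hG] with k hk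
    refine (hP.real_hit_le hω htwo N (k + 1) (K * (k + 1)) hr0.le hrB le_rfl).trans ?_
    rw [← Real.exp_nat_mul, ← Real.exp_add, hrsq]
    refine Real.exp_le_exp.2 ?_
    have hsum : γ * k ≤ ∑ z ∈ Finset.range (k + 1), prevGap ω z * prevGap ω (z + 1) := by
      rw [Finset.sum_range_succ']
      simpa only [prevGap_succ, show prevGap ω 0 = 0 from if_pos rfl, zero_mul, add_zero] using hk
    have h1 : (2 * K + 3) * (k : ℝ) ≤
        harm N * ∑ z ∈ Finset.range (k + 1), prevGap ω z * prevGap ω (z + 1) :=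
      calc (2 * K + 3) * (k : ℝ) ≤ harm N * γ * k :=
            mul_le_mul_of_nonneg_right hN (Nat.cast_nonneg k)
        _ = harm N * (γ * k) := by ring
        _ ≤ _ := mul_le_mul_of_nonneg_left hsum (harm_nonneg N)
    have h2 := mul_le_mul_of_nonneg_left h1 hr0.le
    push_cast
    linarith
  filter_upwards [ae_eventually_notMem_of_real_le (Real.exp_pos _).le
    (Real.exp_lt_one_iff.2 (neg_lt_zero.2 hr0)) hkey] with Y hY
  exact eventually_of_eventually_add (p := fun k : ℕ => ¬∃ m ≤ K * k, Y m = (k : ℤ)) hY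

lemma IsERWLaw.ae_eventually_le {ω : CEnv} (hω : IsCookieEnv ω)
    (htwo : ∀ (z : ℕ) i, 2 ≤ i → ω z i = 1 / 2) {P : Measure (ℕ → ℤ)} (hP : IsERWLaw ω 0 P)
    {γ : ℝ} (hγ : 0 < γ) (hG : ∀ᶠ n : ℕ in atTop,
      γ * n ≤ ∑ z ∈ Finset.range n, (1 - ω z 0) * (1 - ω ((z + 1 : ℕ) : ℤ) 0))
    {ε : ℝ} (hε : 0 < ε) : ∀ᵐ Y ∂P, ∀ᶠ n : ℕ in atTop, (Y n : ℝ) / n ≤ ε := by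
  obtain ⟨K, hK⟩ := exists_nat_gt (1 / ε)
  have hK0 : (0 : ℝ) < K := (one_div_pos.2 hε).trans hK
  filter_upwards [hP.ae_eventually_not_hit hω htwo hγ hG K] with Y hY
  obtain ⟨k₀, hk₀⟩ := eventually_atTop.1 hY
  filter_upwards [tendsto_natCast_atTop_atTop.eventually_ge_atTop ((k₀ : ℝ) / ε),
    eventually_gt_atTop 0] with n hn hn0
  have hn0' : (0 : ℝ) < n := Nat.cast_pos.2 hn0
  rw [div_le_iff₀ hε] at hn
  rw [div_le_iff₀ hn0']
  by_contra! hlt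
  have hYpos : (0 : ℝ) < Y n := (mul_pos hε hn0').trans hlt
  obtain ⟨k, hk⟩ := Int.eq_ofNat_of_zero_le (Int.cast_pos.1 hYpos).le
  have hkY : (Y n : ℝ) = k := by rw [hk]; simp
  rw [hkY] at hlt
  refine hk₀ k ?_ ⟨n, ?_, hk⟩
  · have : (k₀ : ℝ) ≤ k := by linarith
    exact_mod_cast this
  · rw [div_lt_iff₀ hε] at hK
    have : (n : ℝ) ≤ K * k := by nlinarith
    exact_mod_cast this

lemma IsERWLaw.ae_eventually_ge {ω : CEnv} (hω : IsCookieEnv ω) {P : Measure (ℕ → ℤ)}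
    (hP : IsERWLaw ω 0 P) {ε : ℝ} (hε : 0 < ε) :
    ∀ᵐ Y ∂P, ∀ᶠ n : ℕ in atTop, -ε < (Y n : ℝ) / n := by
  have := hP.1
  have hbound : ∀ n : ℕ, P.real {Y : ℕ → ℤ | (Y n : ℝ) ≤ -(ε * n)} ≤ 1 * Real.exp (-(ε ^ 2 / 2)) ^ n := by
    intro n
    have h := hP.real_pathCyl_inter_left_le hω hε.le (ε * n) n 0 (fun _ => 0)
    rw [show cylProb ω 0 (fun _ => 0) 0 = 1 by simp [cylProb], one_mul, zero_add] at h
    refine ((hP.real_le_real_start_inter hω _).trans h).trans ?_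
    calc Real.cosh ε ^ n * Real.exp (ε * (-(ε * n) - ((0 : ℤ) : ℝ)))
        ≤ Real.exp (ε ^ 2 / 2) ^ n * Real.exp (ε * (-(ε * n) - ((0 : ℤ) : ℝ))) :=
          mul_le_mul_of_nonneg_right (pow_le_pow_left₀ (Real.cosh_pos _).le
            (Real.cosh_le_exp_half_sq ε) n) (Real.exp_pos _).le
      _ = 1 * Real.exp (-(ε ^ 2 / 2)) ^ n := by
          rw [one_mul, ← Real.exp_nat_mul, ← Real.exp_nat_mul, ← Real.exp_add]
          congr 1
          push_cast
          ring
  filter_upwards [ae_eventually_notMem_of_real_le (Real.exp_pos _).le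
    (Real.exp_lt_one_iff.2 (neg_lt_zero.2 (by positivity))) (Eventually.of_forall hbound)] with Y hY
  filter_upwards [hY, eventually_gt_atTop 0] with n hn hn0
  rw [lt_div_iff₀ (Nat.cast_pos.2 hn0), neg_mul]
  exact not_le.1 hn

lemma shiftSeq_iterate {α : Type*} (u : ℕ → α) (z n : ℕ) : shiftSeq^[z] u n = u (n + z) := by
  induction z generalizing n with
  | zero => rfl
  | succ z ih =>
    rw [Function.iterate_succ_apply', shiftSeq, ih]
    congr 1
    ring

lemma measurable_restrictNN : Measurable restrictNN :=
  measurable_pi_lambda _ fun x => measurable_pi_apply (x : ℤ)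

lemma IsStatErgEnv.ae_all_cookies_eq_half {Pr : Measure CEnv} (hstat : IsStatErgEnv Pr)
    (htwo : ∀ᵐ ω ∂Pr, ∀ i, 2 ≤ i → ω 0 i = 1 / 2) :
    ∀ᵐ ω ∂Pr, ∀ (z : ℕ) i, 2 ≤ i → ω z i = 1 / 2 := by
  have hmeas : MeasurableSet {u : ℕ → ℕ → ℝ | ∀ i, 2 ≤ i → u 0 i = 1 / 2} := by
    have : {u : ℕ → ℕ → ℝ | ∀ i, 2 ≤ i → u 0 i = 1 / 2} =
        ⋂ i : ℕ, ⋂ _ : 2 ≤ i, {u : ℕ → ℕ → ℝ | u 0 i = 1 / 2} := by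
      ext u; simp
    rw [this]
    exact MeasurableSet.iInter fun i => MeasurableSet.iInter fun _ =>
      measurableSet_eq_fun ((measurable_pi_apply i).comp (measurable_pi_apply 0)) measurable_const
  have h0 : ∀ᵐ u ∂(Pr.map restrictNN), ∀ i, 2 ≤ i → u 0 i = 1 / 2 :=
    (ae_map_iff measurable_restrictNN.aemeasurable hmeas).2 (by simpa [restrictNN] using htwo)
  refine ae_all_iff.2 fun z => ?_
  have hz := (hstat.toMeasurePreserving.iterate z).quasiMeasurePreserving.ae h0
  filter_upwards [ae_of_ae_map measurable_restrictNN.aemeasurable hz] with ω hω i hi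
  have := hω i hi
  rwa [shiftSeq_iterate, zero_add] at this

lemma IsStatErgEnv.ae_eventually_le_sum {Pr : Measure CEnv} [IsProbabilityMeasure Pr]
    (hcookie : ∀ᵐ ω ∂Pr, IsCookieEnv ω) (hstat : IsStatErgEnv Pr)
    (hnon : 0 < Pr {ω | ω 0 0 < 1 ∧ ω 1 0 < 1}) :
    ∀ᵐ ω ∂Pr, ∃ γ : ℝ, 0 < γ ∧ ∀ᶠ n : ℕ in atTop,
      γ * n ≤ ∑ z ∈ Finset.range n, (1 - ω z 0) * (1 - ω ((z + 1 : ℕ) : ℤ) 0) := by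
  have hprob : IsProbabilityMeasure (Pr.map restrictNN) :=
    Measure.isProbabilityMeasure_map measurable_restrictNN.aemeasurable
  let d : ℝ → ℝ := fun x => max 0 (min 1 (1 - x))
  have hd : Measurable d := by fun_prop
  have hd0 : ∀ x, 0 ≤ d x := fun x => le_max_left _ _
  have hd1 : ∀ x, d x ≤ 1 := fun x => max_le zero_le_one (min_le_left _ _)
  have hdpos : ∀ x, 0 < d x ↔ x < 1 := fun x => by simp [d]
  have hdeq : ∀ x ∈ Icc (1 / 2 : ℝ) 1, d x = 1 - x := fun x hx => by
    rw [show d x = max 0 (min 1 (1 - x)) from rfl, min_eq_right (by linarith [hx.1]),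
      max_eq_right (by linarith [hx.2])]
  let g : (ℕ → ℕ → ℝ) → ℝ := fun u => d (u 0 0) * d (u 1 0)
  have hg : Measurable g := by fun_prop
  have hg0 : ∀ u, 0 ≤ g u := fun u => mul_nonneg (hd0 _) (hd0 _)
  have hg1 : ∀ u, g u ≤ 1 := fun u => mul_le_one₀ (hd1 _) (hd0 _) (hd1 _)
  have hpos : 0 < ∫ u, g u ∂(Pr.map restrictNN) := by
    have hint : Integrable g (Pr.map restrictNN) :=
      Integrable.of_bound hg.aestronglyMeasurable 1 (ae_of_all _ fun u => by
        rw [Real.norm_of_nonneg (hg0 u)]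
        exact hg1 u)
    rw [integral_pos_iff_support_of_nonneg hg0 hint,
      Measure.map_apply measurable_restrictNN (measurableSet_support hg)]
    refine hnon.trans_le (measure_mono fun ω hω => ?_)
    exact (mul_pos ((hdpos _).2 hω.1) ((hdpos _).2 hω.2)).ne'
  have h := Ergodic.ae_eventually_le_birkhoffSum hstat hg hg0 hg1 hpos
  filter_upwards [ae_of_ae_map measurable_restrictNN.aemeasurable h, hcookie] with ω ⟨γ, hγ, hω⟩ hc
  refine ⟨γ, hγ, ?_⟩
  filter_upwards [hω] with n hn
  refine hn.trans_eq (Finset.sum_congr rfl fun z _ => ?_)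
  rw [show g (shiftSeq^[z] (restrictNN ω)) = d (shiftSeq^[z] (restrictNN ω) 0 0) *
    d (shiftSeq^[z] (restrictNN ω) 1 0) from rfl, shiftSeq_iterate, shiftSeq_iterate, zero_add,
    add_comm 1 z, ← hdeq _ (hc z 0), ← hdeq _ (hc ((z + 1 : ℕ) : ℤ) 0)]
  rfl

/-- Theorem 24, zero speed. If `(ω(x))_{x≥0}` is stationary and
ergodic under `Pr`, `Pr`-a.s. `ω(0,i) = 1/2` for all `i ≥ 3`, and
`Pr[ω(0,1) < 1 and ω(1,1) < 1] > 0`, then `P_0`-a.s. `X_n/n → 0`. -/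
theorem erw_zero_speed (Pr : Measure CEnv) [IsProbabilityMeasure Pr]
    (hcookie : ∀ᵐ ω ∂Pr, IsCookieEnv ω)
    (hstat : IsStatErgEnv Pr)
    (htwo : ∀ᵐ ω ∂Pr, ∀ i, 2 ≤ i → ω 0 i = 1/2)
    (hnon : 0 < Pr {ω | ω 0 0 < 1 ∧ ω 1 0 < 1})
    (κ : Kernel CEnv (ℕ → ℤ)) [IsMarkovKernel κ]
    (hκ : ∀ ω, IsCookieEnv ω → IsERWLaw ω 0 (κ ω)) :
    ∀ᵐ p ∂(Pr.compProd κ),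
      Tendsto (fun n : ℕ => (p.2 n : ℝ) / (n : ℝ)) atTop (𝓝 0) := by
  have hmeas : MeasurableSet {p : CEnv × (ℕ → ℤ) |
      Tendsto (fun n : ℕ => (p.2 n : ℝ) / (n : ℝ)) atTop (𝓝 0)} :=
    measurableSet_tendsto _ fun n =>
      ((measurable_of_countable fun z : ℤ => (z : ℝ)).comp
        ((measurable_pi_apply n).comp measurable_snd)).div_const _
  refine Measure.ae_compProd_of_ae_ae hmeas ?_
  filter_upwards [hcookie, hstat.ae_all_cookies_eq_half htwo,
    hstat.ae_eventually_le_sum hcookie hnon] with ω hω h2 ⟨γ, hγ, hG⟩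
  have hP := hκ ω hω
  have hupper : ∀ᵐ Y ∂κ ω, ∀ j : ℕ, ∀ᶠ n : ℕ in atTop, (Y n : ℝ) / n ≤ 1 / ((j : ℝ) + 1) :=
    ae_all_iff.2 fun j => hP.ae_eventually_le hω h2 hγ hG Nat.one_div_pos_of_nat
  have hlower : ∀ᵐ Y ∂κ ω, ∀ j : ℕ, ∀ᶠ n : ℕ in atTop, -(1 / ((j : ℝ) + 1)) < (Y n : ℝ) / n :=
    ae_all_iff.2 fun j => hP.ae_eventually_ge hω Nat.one_div_pos_of_nat
  filter_upwards [hupper, hlower] with Y hu hl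
  refine tendsto_order.2 ⟨fun a ha => ?_, fun a ha => ?_⟩
  · obtain ⟨j, hj⟩ := exists_nat_one_div_lt (neg_pos.2 ha)
    filter_upwards [hl j] with n hn
    linarith
  · obtain ⟨j, hj⟩ := exists_nat_one_div_lt ha
    filter_upwards [hu j] with n hn
    linarith

end
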